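/- Let (R,m,k) be a noetherian local ring. The minimal free resolution of k is eventually periodic (Ω^n_R k ≅ Ω^{n+a}_R k for some n ≥ 0, a > 0) if and only if R is a hypersurface. -/

import Mathlib

open CategoryTheory IsLocalRing

noncomputable def ExtMod (R : Type) [CommRing R] (M N : Type) [AddCommGroup M] [Module R M]
    [AddCommGroup N] [Module R N] (i : ℕ) : ModuleCat R :=
  ((Ext R (ModuleCat.{0} R) i).obj (Opposite.op (ModuleCat.of R M))).obj (ModuleCat.of R N)

noncomputable def mgrade (R : Type) [CommRing R] (M : Type) [AddCommGroup M] [Module R M] : ℕ :=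
  sInf {i | Nontrivial (ExtMod R M R i)}

def IsTotallySelfDual (R : Type) [CommRing R] (M : Type) [AddCommGroup M] [Module R M] : Prop :=
  Nontrivial M ∧ Nonempty (ExtMod R M R (mgrade R M) ≃ₗ[R] M) ∧
    ∀ i, i ≠ mgrade R M → Subsingleton (ExtMod R M R i)

/-- A minimal free resolution of `M` over a local ring `R`: a resolution by finite free
modules all of whose differentials (and the augmentation) have image inside `𝔪`-times
the target (resp. have kernel inside `𝔪 F₀`). -/
structure MinFreeRes (R : Type) [CommRing R] [IsLocalRing R]
    (M : Type) [AddCommGroup M] [Module R M] where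
  F : ℕ → ModuleCat.{0} R
  free : ∀ n, Module.Free R (F n)
  fin : ∀ n, Module.Finite R (F n)
  d : ∀ n, F (n + 1) →ₗ[R] F n
  aug : F 0 →ₗ[R] M
  aug_surj : Function.Surjective aug
  exact_aug : LinearMap.ker aug = LinearMap.range (d 0)
  exact : ∀ n, LinearMap.ker (d n) = LinearMap.range (d (n + 1))
  minimal : ∀ n, LinearMap.range (d n) ≤ (maximalIdeal R) • (⊤ : Submodule R (F n))

namespace MinFreeRes

variable {R : Type} [CommRing R] [IsLocalRing R]
  {M : Type} [AddCommGroup M] [Module R M]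

/-- The `n`-th syzygy of `M` with respect to a minimal free resolution:
`Ω⁰ M = M` and `Ωⁿ⁺¹ M = Im(dₙ) = Ker(dₙ₋₁)`. -/
noncomputable def Syz (C : MinFreeRes R M) : ℕ → ModuleCat.{0} R
  | 0 => ModuleCat.of R M
  | n + 1 => ModuleCat.of R (LinearMap.range (C.d n))

/-- A minimal free resolution is self-dual if it is bounded, of length `r`, and is
isomorphic (as a complex) to its `R`-dual complex with reversed indexing. -/
def SelfDual (C : MinFreeRes R M) : Prop :=
  ∃ r : ℕ, (∀ n, r < n → Subsingleton (C.F n)) ∧ Nontrivial (C.F r) ∧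
    ∃ e : ∀ ⦃m n : ℕ⦄, m + n = r → (C.F n ≃ₗ[R] Module.Dual R (C.F m)),
      ∀ (q n : ℕ) (hp : (q + 1) + n = r) (hq : q + (n + 1) = r),
        (e hp).toLinearMap ∘ₗ C.d n = (C.d q).dualMap ∘ₗ (e hq).toLinearMap

/-- A minimal free resolution is eventually periodic with period `a` if
`Ωⁿ M ≅ Ωⁿ⁺ᵃ M` for some `n`. -/
def EventuallyPeriodic (C : MinFreeRes R M) (a : ℕ) : Prop :=
  0 < a ∧ ∃ n : ℕ, Nonempty (C.Syz n ≃ₗ[R] C.Syz (n + a))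

end MinFreeRes

/-- Stable isomorphism: `X ⊕ P ≅ Y ⊕ Q` for some finite free `P`, `Q`. -/
def StablyIso (R : Type) [CommRing R] (X Y : Type) [AddCommGroup X] [Module R X]
    [AddCommGroup Y] [Module R Y] : Prop :=
  ∃ (P Q : ModuleCat.{0} R), Module.Free R P ∧ Module.Finite R P ∧
    Module.Free R Q ∧ Module.Finite R Q ∧ Nonempty ((X × P) ≃ₗ[R] (Y × Q))

/-- A noetherian local ring is regular if its maximal ideal can be generated by
`dim R` elements. -/
def IsRegularLocal (R : Type) [CommRing R] [IsLocalRing R] : Prop :=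
  ∃ s : Finset R, Ideal.span (s : Set R) = maximalIdeal R ∧
    ((s.card : ℕ∞) : WithBot ℕ∞) = ringKrullDim R

/-- A noetherian local ring is a hypersurface if its `𝔪`-adic completion is isomorphic
to `S/(f)` for some regular local ring `S` and `f ∈ S`. -/
def IsHypersurface (R : Type) [CommRing R] [IsLocalRing R] : Prop :=
  ∃ (S : Type) (_ : CommRing S) (_ : IsLocalRing S) (_ : IsNoetherianRing S)
    (_ : IsRegularLocal S) (f : S),
    Nonempty (AdicCompletion (maximalIdeal R) R ≃+* S ⧸ Ideal.span {f})

section MinimalCovers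

variable {R : Type} [CommRing R] [IsLocalRing R]

theorem surjective_of_minimal_cover {F F' M M' : Type} [AddCommGroup F] [Module R F]
    [AddCommGroup F'] [Module R F'] [Module.Finite R F']
    [AddCommGroup M] [Module R M] [AddCommGroup M'] [Module R M']
    (p : F →ₗ[R] M) (hp : Function.Surjective p) (p' : F' →ₗ[R] M')
    (hk' : LinearMap.ker p' ≤ maximalIdeal R • (⊤ : Submodule R F'))
    (φ : M ≃ₗ[R] M') (ε : F →ₗ[R] F') (hε : p' ∘ₗ ε = φ.toLinearMap ∘ₗ p) :
    Function.Surjective ε := by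
  rw [← LinearMap.range_eq_top]
  refine top_le_iff.mp (Submodule.le_of_le_smul_of_le_jacobson_bot Module.Finite.fg_top
    (IsLocalRing.maximalIdeal_le_jacobson ⊥) ?_)
  intro x _
  obtain ⟨y, hy⟩ := hp (φ.symm (p' x))
  have hxy : x - ε y ∈ LinearMap.ker p' := by
    have := LinearMap.congr_fun hε y
    simp only [LinearMap.comp_apply, LinearEquiv.coe_coe] at this
    simp [this, hy]
  have := hk' hxy
  rw [show x = ε y + (x - ε y) by abel]
  exact Submodule.add_mem_sup ⟨y, rfl⟩ this

/-- Two minimal finite free covers of isomorphic modules are isomorphic. -/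
theorem exists_equiv_of_minimal_covers {F F' M M' : Type} [AddCommGroup F] [Module R F]
    [AddCommGroup F'] [Module R F'] [Module.Finite R F] [Module.Finite R F']
    [Module.Free R F] [Module.Free R F']
    [AddCommGroup M] [Module R M] [AddCommGroup M'] [Module R M']
    (p : F →ₗ[R] M) (hp : Function.Surjective p) (p' : F' →ₗ[R] M')
    (hp' : Function.Surjective p')
    (hk : LinearMap.ker p ≤ maximalIdeal R • (⊤ : Submodule R F))
    (hk' : LinearMap.ker p' ≤ maximalIdeal R • (⊤ : Submodule R F'))
    (φ : M ≃ₗ[R] M') :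
    ∃ e : F ≃ₗ[R] F', p' ∘ₗ e.toLinearMap = φ.toLinearMap ∘ₗ p := by
  obtain ⟨ε, hε⟩ := Module.projective_lifting_property p' (φ.toLinearMap ∘ₗ p) hp'
  obtain ⟨δ, hδ⟩ := Module.projective_lifting_property p (φ.symm.toLinearMap ∘ₗ p') hp
  have hs := surjective_of_minimal_cover p hp p' hk' φ ε hε
  have hs' := surjective_of_minimal_cover p' hp' p hk φ.symm δ hδ
  have hinj : Function.Injective (δ ∘ₗ ε) :=
    OrzechProperty.injective_of_surjective_endomorphism _ (hs'.comp hs)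
  have hεi : Function.Injective ε := by
    rw [LinearMap.coe_comp] at hinj
    exact hinj.of_comp
  exact ⟨LinearEquiv.ofBijective ε ⟨hεi, hs⟩, hε⟩

theorem nonempty_ker_equiv_of_minimal_covers {F F' M M' : Type} [AddCommGroup F] [Module R F]
    [AddCommGroup F'] [Module R F'] [Module.Finite R F] [Module.Finite R F']
    [Module.Free R F] [Module.Free R F']
    [AddCommGroup M] [Module R M] [AddCommGroup M'] [Module R M']
    (p : F →ₗ[R] M) (hp : Function.Surjective p) (p' : F' →ₗ[R] M')
    (hp' : Function.Surjective p')
    (hk : LinearMap.ker p ≤ maximalIdeal R • (⊤ : Submodule R F))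
    (hk' : LinearMap.ker p' ≤ maximalIdeal R • (⊤ : Submodule R F'))
    (φ : M ≃ₗ[R] M') :
    Nonempty (LinearMap.ker p ≃ₗ[R] LinearMap.ker p') := by
  obtain ⟨e, he⟩ := exists_equiv_of_minimal_covers p hp p' hp' hk hk' φ
  refine ⟨e.submoduleMap (LinearMap.ker p) ≪≫ₗ LinearEquiv.ofEq _ _ ?_⟩
  ext x
  constructor
  · rintro ⟨y, hy, rfl⟩
    have := LinearMap.congr_fun he y
    simp only [LinearMap.comp_apply, LinearEquiv.coe_coe] at this
    have hy' : p y = 0 := hy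
    simp [this, hy']
  · intro hx
    have := LinearMap.congr_fun he (e.symm x)
    simp only [LinearMap.comp_apply, LinearEquiv.coe_coe, LinearEquiv.apply_symm_apply] at this
    refine ⟨e.symm x, ?_, by simp⟩
    have hx' : p' x = 0 := hx
    rw [hx'] at this
    have : p (e.symm x) = 0 := by simpa using this.symm
    exact this

end MinimalCovers

namespace MinFreeRes

variable {R : Type} [CommRing R] [IsLocalRing R] {M : Type} [AddCommGroup M] [Module R M]

instance (C : MinFreeRes R M) (n : ℕ) : Module.Free R (C.F n) := C.free n

instance (C : MinFreeRes R M) (n : ℕ) : Module.Finite R (C.F n) := C.fin n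

/-- The minimal cover of the `n`-th syzygy by the `n`-th term of the resolution. -/
noncomputable def cover (C : MinFreeRes R M) : ∀ n, C.F n →ₗ[R] C.Syz n
  | 0 => C.aug
  | n + 1 => (C.d n).rangeRestrict

theorem cover_surjective (C : MinFreeRes R M) : ∀ n, Function.Surjective (C.cover n)
  | 0 => C.aug_surj
  | n + 1 => (C.d n).surjective_rangeRestrict

theorem ker_cover (C : MinFreeRes R M) : ∀ n, LinearMap.ker (C.cover n) = LinearMap.range (C.d n)
  | 0 => C.exact_aug
  | n + 1 => (LinearMap.ker_rangeRestrict (C.d n)).trans (C.exact n)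

theorem ker_cover_le (C : MinFreeRes R M) (n : ℕ) :
    LinearMap.ker (C.cover n) ≤ maximalIdeal R • (⊤ : Submodule R (C.F n)) :=
  (C.ker_cover n).trans_le (C.minimal n)

/-- The next syzygy is the kernel of the minimal cover. -/
noncomputable def syzSuccEquiv (C : MinFreeRes R M) (n : ℕ) :
    C.Syz (n + 1) ≃ₗ[R] LinearMap.ker (C.cover n) :=
  LinearEquiv.ofEq _ _ (C.ker_cover n).symm

theorem nonempty_syz_equiv_add (C : MinFreeRes R M) {n m : ℕ}
    (h : Nonempty (C.Syz n ≃ₗ[R] C.Syz m)) (i : ℕ) :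
    Nonempty (C.Syz (n + i) ≃ₗ[R] C.Syz (m + i)) := by
  induction i with
  | zero => exact h
  | succ i ih =>
    obtain ⟨e⟩ := ih
    obtain ⟨e'⟩ := nonempty_ker_equiv_of_minimal_covers _ (C.cover_surjective (n + i)) _
      (C.cover_surjective (m + i)) (C.ker_cover_le _) (C.ker_cover_le _) e
    exact ⟨C.syzSuccEquiv (n + i) ≪≫ₗ e' ≪≫ₗ (C.syzSuccEquiv (m + i)).symm⟩

theorem finrank_eq_of_syz_equiv (C : MinFreeRes R M) {n m : ℕ}
    (h : Nonempty (C.Syz n ≃ₗ[R] C.Syz m)) :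
    Module.finrank R (C.F n) = Module.finrank R (C.F m) := by
  obtain ⟨e⟩ := h
  obtain ⟨e', -⟩ := exists_equiv_of_minimal_covers _ (C.cover_surjective n) _
      (C.cover_surjective m) (C.ker_cover_le _) (C.ker_cover_le _) e
  exact e'.finrank_eq

theorem exists_finrank_le_of_periodic (C : MinFreeRes R M) {n a : ℕ} (ha : 0 < a)
    (h : Nonempty (C.Syz n ≃ₗ[R] C.Syz (n + a))) :
    ∃ B, ∀ i, Module.finrank R (C.F i) ≤ B := by
  refine ⟨(Finset.range (n + a)).sup fun i => Module.finrank R (C.F i), fun i => ?_⟩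
  induction i using Nat.strong_induction_on with
  | _ i ih =>
    by_cases hi : i < n + a
    · exact Finset.le_sup (f := fun i => Module.finrank R (C.F i)) (Finset.mem_range.mpr hi)
    · have hh := C.finrank_eq_of_syz_equiv (C.nonempty_syz_equiv_add h (i - (n + a)))
      rw [show n + a + (i - (n + a)) = i by omega] at hh
      rw [← hh]
      exact ih _ (by omega)

end MinFreeRes

section Existence

variable {R : Type} [CommRing R] [IsLocalRing R]

/-- A finite module over a local ring has a minimal finite free cover. -/
theorem exists_minimal_cover (M : Type) [AddCommGroup M] [Module R M] [Module.Finite R M] :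
    ∃ (b : ℕ) (p : (Fin b → R) →ₗ[R] M), Function.Surjective p ∧
      LinearMap.ker p ≤ maximalIdeal R • (⊤ : Submodule R (Fin b → R)) := by
  classical
  have hex := Module.Finite.exists_fin' R M
  let b := Nat.find hex
  obtain ⟨p, hp⟩ := Nat.find_spec hex
  refine ⟨b, p, hp, fun v hv => ?_⟩
  have hall : ∀ i, v i ∈ maximalIdeal R := by
    intro i
    by_contra hi
    have hu : IsUnit (v i) := by simpa using hi
    obtain ⟨b', hb'⟩ : ∃ b', b = b' + 1 := ⟨b - 1, by have := i.2; omega⟩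
    have hlt : b' < b := by omega
    apply Nat.find_min hex hlt
    let j : Fin b' ≃ {x : Fin b // x ≠ i} := by
      refine Fintype.equivOfCardEq ?_
      rw [Fintype.card_subtype_compl, Fintype.card_subtype_eq, Fintype.card_fin, Fintype.card_fin]
      omega
    let q : (Fin b' → R) →ₗ[R] M := Fintype.linearCombination R (fun x => p (Pi.single (j x).1 1))
    refine ⟨q, ?_⟩
    rw [← LinearMap.range_eq_top, Fintype.range_linearCombination, ← top_le_iff]
    have hptop : Submodule.span R (Set.range fun x => p (Pi.single x 1)) = ⊤ := by
      rw [← LinearMap.range_eq_top] at hp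
      rw [← hp, ← Submodule.map_top, ← (Pi.basisFun R (Fin b)).span_eq, Submodule.map_span,
        ← Set.range_comp]
      congr 2
      ext x
      simp
    rw [← hptop, Submodule.span_le]
    rintro _ ⟨x, rfl⟩
    have hmem : ∀ x, x ≠ i → p (Pi.single x 1) ∈
        Submodule.span R (Set.range fun x => p (Pi.single (j x).1 1)) := by
      intro x hx
      refine Submodule.subset_span ⟨j.symm ⟨x, hx⟩, by simp⟩
    by_cases hx : x = i
    · subst hx
      have h0 : ∑ y, v y • p (Pi.single y 1) = 0 := by
        have : p v = 0 := hv
        rw [← this]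
        conv_rhs => rw [← Finset.univ_sum_single v]
        rw [map_sum]
        refine Finset.sum_congr rfl fun y _ => ?_
        rw [← map_smul, ← Pi.single_smul, smul_eq_mul, mul_one]
      rw [← Finset.add_sum_erase _ _ (Finset.mem_univ x)] at h0
      have h1 : v x • p (Pi.single x 1) ∈
          Submodule.span R (Set.range fun x => p (Pi.single (j x).1 1)) := by
        rw [eq_neg_of_add_eq_zero_left h0]
        refine Submodule.neg_mem _ (Submodule.sum_mem _ fun y hy => Submodule.smul_mem _ _ ?_)
        exact hmem y (Finset.ne_of_mem_erase hy)
      exact (Submodule.smul_mem_iff_of_isUnit _ hu).mp h1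
    · exact hmem x hx
  rw [← Finset.univ_sum_single v]
  refine Submodule.sum_mem _ fun i _ => ?_
  have : Pi.single i (v i) = v i • (Pi.single i 1 : Fin b → R) := by
    rw [← Pi.single_smul, smul_eq_mul, mul_one]
  rw [this]
  exact Submodule.smul_mem_smul (hall i) trivial

/-- The successive kernels in the construction of a minimal free resolution. -/
noncomputable def minimalKernels [IsNoetherianRing R] (M : Type) [AddCommGroup M] [Module R M]
    [Module.Finite R M] : ℕ → Σ b : ℕ, Submodule R (Fin b → R)
  | 0 => ⟨_, LinearMap.ker (exists_minimal_cover (R := R) M).choose_spec.choose⟩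
  | n + 1 => ⟨_, LinearMap.ker
      (exists_minimal_cover (R := R) (minimalKernels M n).2).choose_spec.choose⟩

theorem nonempty_minFreeRes [IsNoetherianRing R] (M : Type) [AddCommGroup M] [Module R M]
    [Module.Finite R M] : Nonempty (MinFreeRes R M) := by
  let s := minimalKernels (R := R) M
  let q : ∀ n, (Fin (s (n + 1)).1 → R) →ₗ[R] (s n).2 := fun n =>
    (exists_minimal_cover (R := R) (minimalKernels M n).2).choose_spec.choose
  have hq : ∀ n, Function.Surjective (q n) := fun n =>
    (exists_minimal_cover (R := R) (minimalKernels M n).2).choose_spec.choose_spec.1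
  have hqk : ∀ n, LinearMap.ker (q n) = (s (n + 1)).2 := fun n => rfl
  have hr : ∀ n, LinearMap.range ((s n).2.subtype ∘ₗ q n) = (s n).2 := fun n => by
    rw [LinearMap.range_comp_of_range_eq_top _ (LinearMap.range_eq_top.mpr (hq n)),
      Submodule.range_subtype]
  refine ⟨{
    F := fun n => ModuleCat.of R (Fin (s n).1 → R)
    free := fun n => inferInstanceAs (Module.Free R (Fin (s n).1 → R))
    fin := fun n => inferInstanceAs (Module.Finite R (Fin (s n).1 → R))
    d := fun n => (s n).2.subtype ∘ₗ q n
    aug := (exists_minimal_cover (R := R) M).choose_spec.choose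
    aug_surj := (exists_minimal_cover (R := R) M).choose_spec.choose_spec.1
    exact_aug := (hr 0).symm
    exact := fun n => ?_
    minimal := fun n => ?_ }⟩
  · refine Eq.trans ?_ (hr (n + 1)).symm
    rw [LinearMap.ker_comp_of_ker_eq_bot _ (Submodule.ker_subtype _), hqk]
  · refine (hr n).trans_le ?_
    cases n with
    | zero => exact (exists_minimal_cover (R := R) M).choose_spec.choose_spec.2
    | succ n => 
      exact (exists_minimal_cover (R := R) (minimalKernels M n).2).choose_spec.choose_spec.2

end Existence

section KoszulData

variable {S : Type} [CommRing S]

/-- Endomorphisms that shift a family of submodules indexed by the integers by `k`. -/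
def gradedEnd {E : Type} [AddCommGroup E] [Module S E] (gr : ℤ → Submodule S E) (k : ℤ) :
    Submodule S (Module.End S E) where
  carrier := {φ | ∀ n, ∀ u ∈ gr n, φ u ∈ gr (n + k)}
  add_mem' := fun hφ hψ n u hu => add_mem (hφ n u hu) (hψ n u hu)
  zero_mem' := fun _ _ _ => zero_mem _
  smul_mem' := fun c _ hφ n u hu => Submodule.smul_mem _ c (hφ n u hu)

theorem apply_mem_smul_of_mem_smul_gradedEnd {E : Type} [AddCommGroup E] [Module S E]
    {gr : ℤ → Submodule S E} {k : ℤ} {J : Ideal S} {φ : Module.End S E}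
    (hφ : φ ∈ J • gradedEnd gr k) {n : ℤ} {u : E} (hu : u ∈ gr n) :
    φ u ∈ J • gr (n + k) := by
  refine Submodule.smul_induction_on hφ (fun r hr ψ hψ => ?_) (fun a b ha hb => ?_)
  · exact Submodule.smul_mem_smul hr (hψ n u hu)
  · exact add_mem ha hb

theorem map_mem_smul {M N : Type} [AddCommGroup M] [Module S M] [AddCommGroup N] [Module S N]
    (L : M →ₗ[S] N) {J : Ideal S} {P : Submodule S M} {Q : Submodule S N}
    (h : ∀ x ∈ P, L x ∈ Q) {x : M} (hx : x ∈ J • P) : L x ∈ J • Q := by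
  have : Submodule.map L (J • P) ≤ J • Q := by
    rw [Submodule.map_smul'']
    exact Submodule.smul_mono le_rfl (Submodule.map_le_iff_le_comap.mpr h)
  exact this ⟨x, hx, rfl⟩

/-- A graded module with a square-zero differential `d` of degree `-1` and two anticommuting
square-zero homotopies `s₁`, `s₂` of degree `1` for multiplication by `f₁` and `f₂`; all three maps
have coefficients in `J`. -/
structure KoszulData (J : Ideal S) (f₁ f₂ : S) where
  E : Type
  [grp : AddCommGroup E]
  [mod : Module S E]
  gr : ℤ → Submodule S E
  proj : ∀ n, Module.Projective S (gr n)
  gr_neg : ∀ n < 0, gr n = ⊥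
  d : Module.End S E
  s₁ : Module.End S E
  s₂ : Module.End S E
  d_mem : d ∈ J • gradedEnd gr (-1)
  s₁_mem : s₁ ∈ J • gradedEnd gr 1
  s₂_mem : s₂ ∈ J • gradedEnd gr 1
  d_d : ∀ u, d (d u) = 0
  s₁_s₁ : ∀ u, s₁ (s₁ u) = 0
  s₂_s₂ : ∀ u, s₂ (s₂ u) = 0
  s₁_s₂ : ∀ u, s₁ (s₂ u) + s₂ (s₁ u) = 0
  d_s₁ : ∀ u, d (s₁ u) + s₁ (d u) = f₁ • u
  d_s₂ : ∀ u, d (s₂ u) + s₂ (d u) = f₂ • u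
  one : E
  one_mem : one ∈ gr 0
  aug : E →ₗ[S] S
  aug_one : aug one = 1

attribute [instance] KoszulData.grp KoszulData.mod

namespace KoszulData

variable {J : Ideal S}

/-- The trivial datum. -/
noncomputable def trivial (J : Ideal S) : KoszulData J 0 0 where
  E := S
  gr := fun n => if n = 0 then ⊤ else ⊥
  proj := fun n => by
    by_cases hn : n = 0
    · rw [if_pos hn]
      exact Module.Projective.of_equiv (Submodule.topEquiv (R := S) (M := S)).symm
    · rw [if_neg hn]
      infer_instance
  gr_neg := fun n hn => if_neg hn.ne
  d := 0
  s₁ := 0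
  s₂ := 0
  d_mem := zero_mem _
  s₁_mem := zero_mem _
  s₂_mem := zero_mem _
  d_d := fun _ => rfl
  s₁_s₁ := fun _ => rfl
  s₂_s₂ := fun _ => rfl
  s₁_s₂ := fun _ => by simp
  d_s₁ := fun _ => by simp
  d_s₂ := fun _ => by simp
  one := 1
  one_mem := by simp
  aug := LinearMap.id
  aug_one := rfl

/-- The map `φ ↦ φ ⊕ -φ`. -/
def prodNeg (E : Type) [AddCommGroup E] [Module S E] :
    Module.End S E →ₗ[S] Module.End S (E × E) where
  toFun φ := φ.prodMap (-φ)
  map_add' φ ψ := by ext <;> simp [add_comm]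
  map_smul' c φ := by ext <;> simp

/-- The product of two submodules, as a submodule, is the product of the two modules. -/
def prodSubmoduleEquiv {M N : Type} [AddCommGroup M] [Module S M] [AddCommGroup N] [Module S N]
    (P : Submodule S M) (Q : Submodule S N) : P.prod Q ≃ₗ[S] P × Q where
  toFun u := (⟨u.1.1, u.2.1⟩, ⟨u.1.2, u.2.2⟩)
  invFun v := ⟨(v.1.1, v.2.1), v.1.2, v.2.2⟩
  map_add' _ _ := rfl
  map_smul' _ _ := rfl
  left_inv _ := rfl
  right_inv _ := rfl

/-- Adjoin one more generator to a Koszul datum. -/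
noncomputable def step {f₁ f₂ : S} (K : KoszulData J f₁ f₂) {x a b : S} (hx : x ∈ J) (ha : a ∈ J)
    (hb : b ∈ J) : KoszulData J (f₁ + x * a) (f₂ + x * b) :=
  have hneg : ∀ (k : ℤ) (φ : Module.End S K.E), φ ∈ J • gradedEnd K.gr k → prodNeg K.E φ ∈
      J • gradedEnd (fun n => (K.gr n).prod (K.gr (n - 1))) k := fun k φ hφ => by
    refine map_mem_smul (prodNeg K.E) (fun ψ hψ n u hu => ⟨hψ n _ hu.1, ?_⟩) hφ
    have := hψ _ _ hu.2
    simp only [prodNeg, LinearMap.coe_mk, AddHom.coe_mk, LinearMap.prodMap_apply,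
      LinearMap.neg_apply]
    rw [show n + k - 1 = n - 1 + k by ring]
    exact neg_mem this
  have hup : ∀ c ∈ J, c • (LinearMap.inr S K.E K.E ∘ₗ LinearMap.fst S K.E K.E) ∈
      J • gradedEnd (fun n => (K.gr n).prod (K.gr (n - 1))) 1 := fun c hc => by
    refine Submodule.smul_mem_smul hc fun n u hu => ⟨zero_mem _, ?_⟩
    simpa using hu.1
  { E := K.E × K.E
    gr := fun n => (K.gr n).prod (K.gr (n - 1))
    proj := fun n => by
      have := K.proj n
      have := K.proj (n - 1)
      exact Module.Projective.of_equiv (prodSubmoduleEquiv (K.gr n) (K.gr (n - 1))).symm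
    gr_neg := fun n hn => by
      rw [K.gr_neg n hn, K.gr_neg (n - 1) (by omega), Submodule.prod_bot]
    d := prodNeg K.E K.d + x • (LinearMap.inl S K.E K.E ∘ₗ LinearMap.snd S K.E K.E)
    s₁ := prodNeg K.E K.s₁ + a • (LinearMap.inr S K.E K.E ∘ₗ LinearMap.fst S K.E K.E)
    s₂ := prodNeg K.E K.s₂ + b • (LinearMap.inr S K.E K.E ∘ₗ LinearMap.fst S K.E K.E)
    d_mem := by
      refine add_mem (hneg _ _ K.d_mem) (Submodule.smul_mem_smul hx fun n u hu => ⟨?_, zero_mem _⟩)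
      exact hu.2
    s₁_mem := add_mem (hneg _ _ K.s₁_mem) (hup a ha)
    s₂_mem := add_mem (hneg _ _ K.s₂_mem) (hup b hb)
    d_d := fun ⟨u, v⟩ => by simp [prodNeg, K.d_d]
    s₁_s₁ := fun ⟨u, v⟩ => by simp [prodNeg, K.s₁_s₁]
    s₂_s₂ := fun ⟨u, v⟩ => by simp [prodNeg, K.s₂_s₂]
    s₁_s₂ := fun ⟨u, v⟩ => by
      have h1 := K.s₁_s₂ u
      have h2 := K.s₁_s₂ v
      simp only [prodNeg, LinearMap.add_apply, LinearMap.coe_mk, AddHom.coe_mk,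
        LinearMap.prodMap_apply, LinearMap.neg_apply, LinearMap.smul_apply, LinearMap.comp_apply,
        LinearMap.fst_apply, LinearMap.inr_apply, Prod.smul_mk, smul_zero, Prod.mk_add_mk,
        add_zero, map_add, map_neg, map_smul, neg_neg, Prod.mk_eq_zero]
      refine ⟨h1, ?_⟩
      rw [← h2]
      simp only [smul_neg]
      abel
    d_s₁ := fun ⟨u, v⟩ => by
      have h1 := K.d_s₁ u
      have h2 := K.d_s₁ v
      simp only [prodNeg, LinearMap.add_apply, LinearMap.coe_mk, AddHom.coe_mk,
        LinearMap.prodMap_apply, LinearMap.neg_apply, LinearMap.smul_apply, LinearMap.comp_apply,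
        LinearMap.fst_apply, LinearMap.inr_apply, LinearMap.snd_apply, LinearMap.inl_apply,
        Prod.smul_mk, smul_zero, Prod.mk_add_mk, smul_add, smul_neg, smul_smul,
        add_zero, map_add, map_neg, map_smul, neg_neg, add_smul,
        ← h1, ← h2]
      rw [mul_comm a x]
      refine Prod.ext ?_ ?_
      · simp only [Prod.fst_add, Prod.fst_neg]; abel
      · simp only [Prod.snd_add, Prod.snd_neg]; abel
    d_s₂ := fun ⟨u, v⟩ => by
      have h1 := K.d_s₂ u
      have h2 := K.d_s₂ v
      simp only [prodNeg, LinearMap.add_apply, LinearMap.coe_mk, AddHom.coe_mk,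
        LinearMap.prodMap_apply, LinearMap.neg_apply, LinearMap.smul_apply, LinearMap.comp_apply,
        LinearMap.fst_apply, LinearMap.inr_apply, LinearMap.snd_apply, LinearMap.inl_apply,
        Prod.smul_mk, smul_zero, Prod.mk_add_mk, smul_add, smul_neg, smul_smul,
        add_zero, map_add, map_neg, map_smul, neg_neg, add_smul,
        ← h1, ← h2]
      rw [mul_comm b x]
      refine Prod.ext ?_ ?_
      · simp only [Prod.fst_add, Prod.fst_neg]; abel
      · simp only [Prod.snd_add, Prod.snd_neg]; abel
    one := (K.one, 0)
    one_mem := ⟨K.one_mem, zero_mem _⟩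
    aug := K.aug ∘ₗ LinearMap.fst S K.E K.E
    aug_one := K.aug_one }

theorem nonempty_of_mem_mul {f₁ f₂ : S} (h₁ : f₁ ∈ J * J) (h₂ : f₂ ∈ J * J) :
    Nonempty (KoszulData J f₁ f₂) := by
  have h1 : ∀ g₁ g₂, Nonempty (KoszulData J g₁ g₂) → Nonempty (KoszulData J (g₁ + f₁) g₂) := by
    refine Submodule.mul_induction_on h₁ (fun x hx a ha g₁ g₂ h => ?_)
      (fun x y hx hy g₁ g₂ h => ?_)
    · simpa using h.map fun K => K.step hx ha (zero_mem J)
    · rw [← add_assoc]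
      exact hy _ _ (hx _ _ h)
  have h2 : ∀ g₁ g₂, Nonempty (KoszulData J g₁ g₂) → Nonempty (KoszulData J g₁ (g₂ + f₂)) := by
    refine Submodule.mul_induction_on h₂ (fun x hx a ha g₁ g₂ h => ?_)
      (fun x y hx hy g₁ g₂ h => ?_)
    · simpa using h.map fun K => K.step hx (zero_mem J) ha
    · rw [← add_assoc]
      exact hy _ _ (hx _ _ h)
  simpa using h2 _ _ (h1 _ _ ⟨trivial J⟩)

end KoszulData

end KoszulData

section TateData

variable {S : Type} [CommRing S]

/-- A sequence of projective modules with maps `D` of degree `-1` and commuting "divided power"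
shifts `∂₁`, `∂₂` of degree `-2` with `D² = f₁ ∂₁ + f₂ ∂₂`, together with a supply of elements `y`
on which the shifts act like those on divided powers. -/
structure TateData (J : Ideal S) (f₁ f₂ : S) where
  T : ℕ → Type
  [grp : ∀ n, AddCommGroup (T n)]
  [mod : ∀ n, Module S (T n)]
  proj : ∀ n, Module.Projective S (T n)
  D : ∀ n, T (n + 1) →ₗ[S] T n
  shift₁ : ∀ n, T (n + 2) →ₗ[S] T n
  shift₂ : ∀ n, T (n + 2) →ₗ[S] T n
  D_D : ∀ n t, D n (D (n + 1) t) = f₁ • shift₁ n t + f₂ • shift₂ n t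
  D_mem : ∀ n t, D n t ∈ J • (⊤ : Submodule S (T n))
  y : ∀ n, ℕ → T (2 * n)
  shift₁_y_succ : ∀ n a, shift₁ (2 * n) (y (n + 1) (a + 1)) = y n a
  shift₁_y_zero : ∀ n, shift₁ (2 * n) (y (n + 1) 0) = 0
  shift₂_y : ∀ n a, a ≤ n → shift₂ (2 * n) (y (n + 1) a) = y n a
  shift₂_y_last : ∀ n, shift₂ (2 * n) (y (n + 1) (n + 1)) = 0
  aug : T 0 →ₗ[S] S
  aug_y : aug (y 0 0) = 1

attribute [instance] TateData.grp TateData.mod TateData.proj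

namespace KoszulData

variable {J : Ideal S} {f₁ f₂ : S} (K : KoszulData J f₁ f₂)

/-- The bigraded extension of a Koszul datum by divided power variables of degree two. -/
def total (n : ℤ) : Submodule S (ℕ → ℕ → K.E) where
  carrier := {t | ∀ a b : ℕ, t a b ∈ K.gr (n - 2 * a - 2 * b)}
  add_mem' := fun ht hu a b => add_mem (ht a b) (hu a b)
  zero_mem' := fun _ _ => zero_mem _
  smul_mem' := fun c _ ht a b => Submodule.smul_mem _ c (ht a b)

theorem eq_zero_of_mem_total {n : ℕ} {t : ℕ → ℕ → K.E} (ht : t ∈ K.total n) {a b : ℕ}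
    (h : n < a ∨ n < b) : t a b = 0 := by
  have := ht a b
  rw [K.gr_neg _ (by omega)] at this
  exact this

/-- Only finitely many components of an element of `total n` can be nonzero. -/
noncomputable def totalEquiv (n : ℕ) : K.total n ≃ₗ[S]
    ((i : Fin (n + 1) × Fin (n + 1)) → K.gr (n - 2 * (i.1 : ℕ) - 2 * (i.2 : ℕ))) where
  toFun t i := ⟨t.1 i.1 i.2, t.2 i.1 i.2⟩
  map_add' _ _ := rfl
  map_smul' _ _ := rfl
  invFun v := ⟨fun a b => if h : a < n + 1 ∧ b < n + 1 then (v (⟨a, h.1⟩, ⟨b, h.2⟩)).1 else 0,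
    fun a b => by
      dsimp only
      split_ifs with h
      · exact (v (⟨a, h.1⟩, ⟨b, h.2⟩)).2
      · exact zero_mem _⟩
  left_inv t := by
    refine Subtype.ext (funext fun a => funext fun b => ?_)
    dsimp only
    split_ifs with h
    · rfl
    · exact (K.eq_zero_of_mem_total t.2 (by omega)).symm
  right_inv v := by
    funext i
    refine Subtype.ext ?_
    dsimp only
    rw [dif_pos ⟨i.1.2, i.2.2⟩]

theorem projective_total (n : ℕ) : Module.Projective S (K.total n) := by
  have := K.proj
  classical
  exact Module.Projective.of_equiv
    ((DFinsupp.linearEquivFunOnFintype (R := S)).trans (K.totalEquiv n).symm)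

/-- Shift in both divided power directions, followed by an endomorphism applied pointwise. -/
def shiftMap (E : Type) [AddCommGroup E] [Module S E] (i j : ℕ) :
    Module.End S E →ₗ[S] Module.End S (ℕ → ℕ → E) where
  toFun φ :=
    { toFun := fun t a b => φ (t (a + i) (b + j))
      map_add' := fun t u => by funext a b; simp
      map_smul' := fun c t => by funext a b; simp }
  map_add' φ ψ := rfl
  map_smul' c φ := rfl

theorem shiftMap_mem_gradedEnd {i j : ℕ} {k : ℤ} {φ : Module.End S K.E}
    (hφ : φ ∈ gradedEnd K.gr k) :
    shiftMap K.E i j φ ∈ gradedEnd K.total (k - 2 * i - 2 * j) := by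
  intro n t ht a b
  have := hφ _ _ (ht (a + i) (b + j))
  rwa [show n - 2 * ((a + i : ℕ) : ℤ) - 2 * ((b + j : ℕ) : ℤ) + k =
    n + (k - 2 * i - 2 * j) - 2 * a - 2 * b by push_cast; ring] at this

theorem shiftMap_mem_smul_gradedEnd {i j : ℕ} {k l : ℤ} {φ : Module.End S K.E}
    (hφ : φ ∈ J • gradedEnd K.gr k) (hl : k - 2 * i - 2 * j = l) :
    shiftMap K.E i j φ ∈ J • gradedEnd K.total l := by
  subst hl
  exact map_mem_smul (shiftMap K.E i j) (fun ψ hψ => K.shiftMap_mem_gradedEnd hψ) hφ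

/-- The total differential. -/
def totalD : Module.End S (ℕ → ℕ → K.E) :=
  shiftMap K.E 0 0 K.d + shiftMap K.E 1 0 K.s₁ + shiftMap K.E 0 1 K.s₂

theorem totalD_apply (t : ℕ → ℕ → K.E) (a b : ℕ) :
    K.totalD t a b = K.d (t a b) + K.s₁ (t (a + 1) b) + K.s₂ (t a (b + 1)) := rfl

theorem totalD_mem : K.totalD ∈ J • gradedEnd K.total (-1) :=
  add_mem (add_mem (K.shiftMap_mem_smul_gradedEnd K.d_mem (by norm_num))
    (K.shiftMap_mem_smul_gradedEnd K.s₁_mem (by norm_num)))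
    (K.shiftMap_mem_smul_gradedEnd K.s₂_mem (by norm_num))

theorem totalD_mem_smul {n : ℕ} {t : ℕ → ℕ → K.E} (ht : t ∈ K.total (n + 1 : ℕ)) :
    K.totalD t ∈ J • K.total n := by
  have := apply_mem_smul_of_mem_smul_gradedEnd K.totalD_mem ht
  simpa using this

theorem totalD_totalD (t : ℕ → ℕ → K.E) :
    K.totalD (K.totalD t) =
      f₁ • (fun a b => t (a + 1) b) + f₂ • (fun a b => t a (b + 1)) := by
  funext a b
  simp only [totalD_apply, map_add, K.d_d, K.s₁_s₁, K.s₂_s₂, Pi.add_apply, Pi.smul_apply,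
    zero_add, add_zero, ← K.d_s₁, ← K.d_s₂]
  have h := K.s₁_s₂ (t (a + 1) (b + 1))
  rw [← sub_eq_zero, ← h]
  abel

theorem shiftMap_mem_total {n : ℕ} {i j : ℕ} (hij : i + j = 1) {t : ℕ → ℕ → K.E}
    (ht : t ∈ K.total (n + 2 : ℕ)) :
    shiftMap K.E i j (LinearMap.id : Module.End S K.E) t ∈ K.total n := by
  have := K.shiftMap_mem_gradedEnd (i := i) (j := j) (k := 0) (φ := LinearMap.id)
    (fun n u hu => by simpa using hu) _ _ ht
  convert this using 1
  congr 1
  push_cast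
  omega

open Classical in
/-- The element with a single entry `one` at position `(a, n - a)`. -/
noncomputable def single (n a : ℕ) : ℕ → ℕ → K.E :=
  fun i j => if i = a ∧ i + j = n then K.one else 0

theorem single_mem (n a : ℕ) : K.single n a ∈ K.total (2 * n : ℕ) := by
  intro i j
  rw [single]
  split_ifs with h
  · have h1 : ((2 * n : ℕ) : ℤ) - 2 * i - 2 * j = 0 := by omega
    rw [h1]
    exact K.one_mem
  · exact zero_mem _

/-- The Tate construction. -/
noncomputable def tate : TateData J f₁ f₂ where
  T n := K.total n
  proj := K.projective_total
  D n := K.totalD.restrict (p := K.total (n + 1 : ℕ)) (q := K.total n) fun _ ht =>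
    Submodule.smul_le_right (K.totalD_mem_smul ht)
  shift₁ n := (shiftMap K.E 1 0 (LinearMap.id : Module.End S K.E)).restrict
    (p := K.total (n + 2 : ℕ)) (q := K.total n) fun _ ht => K.shiftMap_mem_total rfl ht
  shift₂ n := (shiftMap K.E 0 1 (LinearMap.id : Module.End S K.E)).restrict
    (p := K.total (n + 2 : ℕ)) (q := K.total n) fun _ ht => K.shiftMap_mem_total rfl ht
  D_D n t := Subtype.ext (K.totalD_totalD t)
  D_mem n t := by
    have h := K.totalD_mem_smul t.2
    have h2 : Submodule.map (K.total n).subtype (J • ⊤) = J • K.total n := by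
      rw [Submodule.map_smul'', Submodule.map_top, Submodule.range_subtype]
    rw [← h2] at h
    obtain ⟨u, hu, hut⟩ := h
    have hu' : u = ⟨K.totalD t, Submodule.smul_le_right (K.totalD_mem_smul t.2)⟩ :=
      Subtype.ext hut
    rw [hu'] at hu
    exact hu
  y n a := ⟨K.single n a, K.single_mem n a⟩
  shift₁_y_succ n a := by
    refine Subtype.ext (funext fun i => funext fun j => ?_)
    simp only [LinearMap.coe_restrict_apply, shiftMap, LinearMap.coe_mk, AddHom.coe_mk,
      LinearMap.id_apply, single]
    refine if_congr ?_ rfl rfl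
    omega
  shift₁_y_zero n := by
    refine Subtype.ext (funext fun i => funext fun j => ?_)
    simp only [LinearMap.coe_restrict_apply, shiftMap, LinearMap.coe_mk, AddHom.coe_mk,
      LinearMap.id_apply, single]
    exact if_neg (by omega)
  shift₂_y n a h := by
    refine Subtype.ext (funext fun i => funext fun j => ?_)
    simp only [LinearMap.coe_restrict_apply, shiftMap, LinearMap.coe_mk, AddHom.coe_mk,
      LinearMap.id_apply, single]
    refine if_congr ?_ rfl rfl
    omega
  shift₂_y_last n := by
    refine Subtype.ext (funext fun i => funext fun j => ?_)
    simp only [LinearMap.coe_restrict_apply, shiftMap, LinearMap.coe_mk, AddHom.coe_mk,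
      LinearMap.id_apply, single]
    exact if_neg (by omega)
  aug := K.aug ∘ₗ (LinearMap.proj 0 : (ℕ → K.E) →ₗ[S] K.E) ∘ₗ
    (LinearMap.proj 0 : (ℕ → ℕ → K.E) →ₗ[S] (ℕ → K.E)) ∘ₗ (K.total 0).subtype
  aug_y := by simp [single, K.aug_one]

end KoszulData

end TateData

section LowerBound

theorem mem_smul_top_pi_iff {S ι : Type} [CommRing S] [Finite ι] (I : Ideal S) (v : ι → S) :
    v ∈ I • (⊤ : Submodule S (ι → S)) ↔ ∀ i, v i ∈ I := by
  classical
  have := Fintype.ofFinite ι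
  constructor
  · intro hv i
    have := map_mem_smul (LinearMap.proj i : (ι → S) →ₗ[S] S) (Q := ⊤) (fun _ _ => trivial) hv
    simpa using this
  · intro h
    have : v = ∑ i, v i • (Pi.single i 1 : ι → S) := by
      funext j
      simp [Finset.sum_apply, Pi.single_apply]
    rw [this]
    exact sum_mem fun i _ => Submodule.smul_mem_smul (h i) trivial

theorem exists_lift_of_projective {S P M N : Type} [CommRing S] [AddCommGroup P] [Module S P]
    [AddCommGroup M] [Module S M] [AddCommGroup N] [Module S N] [Module.Projective S P]
    (α : M →ₗ[S] N) (β : P →ₗ[S] N) (h : ∀ x, ∃ w, α w = β x) :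
    ∃ γ : P →ₗ[S] M, ∀ x, α (γ x) = β x := by
  obtain ⟨γ, hγ⟩ := Module.projective_lifting_property α.rangeRestrict
    (β.codRestrict (LinearMap.range α) h) α.surjective_rangeRestrict
  exact ⟨γ, fun x => congrArg Subtype.val (LinearMap.congr_fun hγ x)⟩

variable {S : Type} [CommRing S] [IsLocalRing S] {I : Ideal S} {f₁ f₂ : S}
  {b : ℕ → ℕ} {d : ∀ n, (Fin (b (n + 1)) → S) →ₗ[S] (Fin (b n) → S)}

theorem exists_tate_map (hf₁ : f₁ ∈ I) (hf₂ : f₂ ∈ I) (T : TateData (maximalIdeal S) f₁ f₂)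
    (hexact : ∀ n v, d n v ∈ I • (⊤ : Submodule S (Fin (b n) → S)) →
      ∃ w, v - d (n + 1) w ∈ I • (⊤ : Submodule S (Fin (b (n + 1)) → S)))
    (hexact₀ : ∀ v ∈ maximalIdeal S • (⊤ : Submodule S (Fin (b 0) → S)),
      ∃ w, v - d 0 w ∈ I • (⊤ : Submodule S (Fin (b 0) → S)))
    (e : Fin (b 0) → S) :
    ∃ g : ∀ n, T.T n →ₗ[S] (Fin (b n) → S), g 0 (T.y 0 0) = e ∧
      ∀ n t, d n (g (n + 1) t) - g n (T.D n t) ∈ I • (⊤ : Submodule S (Fin (b n) → S)) := by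
  let Q : ∀ n, (T.T n →ₗ[S] (Fin (b n) → S)) → Prop := fun n g =>
    ∀ t, ∃ w, g (T.D n t) - d n w ∈ I • (⊤ : Submodule S (Fin (b n) → S))
  have step : ∀ n g, Q n g → ∃ g' : T.T (n + 1) →ₗ[S] (Fin (b (n + 1)) → S), Q (n + 1) g' ∧
      ∀ t, d n (g' t) - g (T.D n t) ∈ I • (⊤ : Submodule S (Fin (b n) → S)) := by
    intro n g hg
    have := T.proj (n + 1)
    obtain ⟨g', hg'⟩ := exists_lift_of_projective
      ((I • (⊤ : Submodule S (Fin (b n) → S))).mkQ ∘ₗ d n)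
      ((I • (⊤ : Submodule S (Fin (b n) → S))).mkQ ∘ₗ g ∘ₗ T.D n) (fun t => by
        obtain ⟨w, hw⟩ := hg t
        exact ⟨w, ((Submodule.Quotient.eq _).mpr hw).symm⟩)
    have hg'' : ∀ t, d n (g' t) - g (T.D n t) ∈ I • (⊤ : Submodule S (Fin (b n) → S)) :=
      fun t => (Submodule.Quotient.eq _).mp (hg' t)
    refine ⟨g', fun t => hexact n _ ?_, hg''⟩
    have h := hg'' (T.D (n + 1) t)
    have h' : g (T.D n (T.D (n + 1) t)) ∈ I • (⊤ : Submodule S (Fin (b n) → S)) := by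
      rw [T.D_D, map_add, map_smul, map_smul]
      exact add_mem (Submodule.smul_mem_smul hf₁ trivial) (Submodule.smul_mem_smul hf₂ trivial)
    simpa using add_mem h h'
  let g₀ : T.T 0 →ₗ[S] (Fin (b 0) → S) := (LinearMap.toSpanSingleton S _ e) ∘ₗ T.aug
  have hg₀ : Q 0 g₀ := fun t => hexact₀ _
    (map_mem_smul g₀ (Q := ⊤) (fun _ _ => trivial) (T.D_mem 0 t))
  choose φ hφ using step
  let G : ∀ n, {g // Q n g} := fun n => Nat.rec ⟨g₀, hg₀⟩ (fun n g => ⟨φ n g.1 g.2, (hφ n _ g.2).1⟩) n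
  refine ⟨fun n => (G n).1, ?_, fun n t => (hφ n _ (G n).2).2 t⟩
  change g₀ (T.y 0 0) = e
  simp [g₀, T.aug_y]

theorem lt_of_resolution_mod (hf₁ : f₁ ∈ I) (hf₂ : f₂ ∈ I)
    (hindep : ∀ x y, f₁ * x + f₂ * y ∈ maximalIdeal S * I → x ∈ maximalIdeal S ∧ y ∈ maximalIdeal S)
    (T : TateData (maximalIdeal S) f₁ f₂)
    (hd : ∀ n v, d n v ∈ maximalIdeal S • (⊤ : Submodule S (Fin (b n) → S)))
    (hdd : ∀ n v, d n (d (n + 1) v) ∈ I • (⊤ : Submodule S (Fin (b n) → S)))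
    (hexact : ∀ n v, d n v ∈ I • (⊤ : Submodule S (Fin (b n) → S)) →
      ∃ w, v - d (n + 1) w ∈ I • (⊤ : Submodule S (Fin (b (n + 1)) → S)))
    (hexact₀ : ∀ v ∈ maximalIdeal S • (⊤ : Submodule S (Fin (b 0) → S)),
      ∃ w, v - d 0 w ∈ I • (⊤ : Submodule S (Fin (b 0) → S)))
    (hb : 0 < b 0) (n : ℕ) : n < b (2 * n) := by
  obtain ⟨g, hg₀, hg⟩ := exists_tate_map hf₁ hf₂ T hexact hexact₀ (fun _ => 1)
  have key : ∀ n t, g (n + 2) t ∈ maximalIdeal S • (⊤ : Submodule S (Fin (b (n + 2)) → S)) →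
      g n (T.shift₁ n t) ∈ maximalIdeal S • (⊤ : Submodule S (Fin (b n) → S)) ∧
      g n (T.shift₂ n t) ∈ maximalIdeal S • (⊤ : Submodule S (Fin (b n) → S)) := by
    intro n t ht
    have h1 : d n (d (n + 1) (g (n + 2) t)) ∈
        maximalIdeal S • I • (⊤ : Submodule S (Fin (b n) → S)) :=
      map_mem_smul (d n ∘ₗ d (n + 1)) (fun v _ => hdd n v) ht
    have h2 : d n (d (n + 1) (g (n + 2) t) - g (n + 1) (T.D (n + 1) t)) ∈
        I • maximalIdeal S • (⊤ : Submodule S (Fin (b n) → S)) :=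
      map_mem_smul (d n) (fun v _ => hd n v) (hg (n + 1) t)
    have h3 : d n (g (n + 1) (T.D (n + 1) t)) - g n (T.D n (T.D (n + 1) t)) ∈
        maximalIdeal S • I • (⊤ : Submodule S (Fin (b n) → S)) :=
      map_mem_smul (d n ∘ₗ g (n + 1) - g n ∘ₗ T.D n) (fun v _ => hg n v) (T.D_mem (n + 1) t)
    rw [← Submodule.mul_smul, mul_comm, Submodule.mul_smul] at h2
    have h4 := sub_mem (sub_mem h1 h2) h3
    rw [T.D_D, map_add, map_smul, map_smul, map_sub, ← Submodule.mul_smul] at h4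
    have h5 : f₁ • g n (T.shift₁ n t) + f₂ • g n (T.shift₂ n t) ∈
        (maximalIdeal S * I) • (⊤ : Submodule S (Fin (b n) → S)) := by
      convert h4 using 1
      abel
    rw [mem_smul_top_pi_iff] at h5 ⊢
    rw [mem_smul_top_pi_iff]
    exact ⟨fun i => (hindep _ _ (h5 i)).1, fun i => (hindep _ _ (h5 i)).2⟩
  have indep : ∀ n (c : ℕ → S), g (2 * n) (∑ a ∈ Finset.range (n + 1), c a • T.y n a) ∈
      maximalIdeal S • (⊤ : Submodule S (Fin (b (2 * n)) → S)) →
      ∀ a ≤ n, c a ∈ maximalIdeal S := by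
    intro n
    induction n with
    | zero =>
      intro c hc a ha
      obtain rfl : a = 0 := by omega
      rw [mem_smul_top_pi_iff] at hc
      have := hc ⟨0, hb⟩
      rw [Finset.sum_range_one, map_smul] at this
      change c 0 * g 0 (T.y 0 0) _ ∈ _ at this
      simpa [hg₀] using this
    | succ n ih =>
      intro c hc
      obtain ⟨h1, h2⟩ := key (2 * n) _ hc
      have e1 : T.shift₁ (2 * n) (∑ a ∈ Finset.range (n + 1 + 1), c a • T.y (n + 1) a) =
          ∑ a ∈ Finset.range (n + 1), c (a + 1) • T.y n a := by
        rw [Finset.sum_range_succ', map_add, map_smul, T.shift₁_y_zero, smul_zero, add_zero,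
          map_sum]
        exact Finset.sum_congr rfl fun a _ => by rw [map_smul, T.shift₁_y_succ]
      have e2 : T.shift₂ (2 * n) (∑ a ∈ Finset.range (n + 1 + 1), c a • T.y (n + 1) a) =
          ∑ a ∈ Finset.range (n + 1), c a • T.y n a := by
        rw [Finset.sum_range_succ, map_add, map_smul, T.shift₂_y_last, smul_zero, add_zero,
          map_sum]
        exact Finset.sum_congr rfl fun a ha => by
          rw [map_smul, T.shift₂_y _ _ (by simpa [Nat.lt_succ_iff] using ha)]
      have h1' := ih (fun a => c (a + 1)) (e1 ▸ h1)
      have h2' := ih c (e2 ▸ h2)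
      intro a ha
      rcases Nat.lt_or_ge a (n + 1) with h | h
      · exact h2' a (by omega)
      · obtain rfl : a = n + 1 := by omega
        exact h1' n le_rfl
  have hli : LinearIndependent (ResidueField S)
      (fun (a : Fin (n + 1)) (i : Fin (b (2 * n))) => residue S (g (2 * n) (T.y n a) i)) := by
    rw [Fintype.linearIndependent_iff]
    intro c hc a
    choose s hs using fun a => residue_surjective (R := S) (c a)
    let c' : ℕ → S := fun a => if h : a < n + 1 then s ⟨a, h⟩ else 0
    have hc' : ∀ a : Fin (n + 1), c' a = s a := fun a => dif_pos a.2
    have := indep n c' ?_ a (by omega)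
    · rw [hc', ← residue_eq_zero_iff, hs] at this
      exact this
    · rw [mem_smul_top_pi_iff]
      intro i
      rw [← residue_eq_zero_iff, Finset.sum_range, map_sum, Finset.sum_apply, map_sum]
      refine Eq.trans ?_ (congrFun hc i)
      simp [hc', hs, Finset.sum_apply]
  have := hli.fintype_card_le_finrank
  simp only [Fintype.card_fin, Module.finrank_fin_fun] at this
  exact this

end LowerBound

section Transfer

open scoped TensorProduct

theorem exists_flat_baseChange {R A : Type} [CommRing R] [IsLocalRing R] [CommRing A] [IsLocalRing A]
    [Algebra R A] [Module.Flat R A]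
    (hm : (maximalIdeal R).map (algebraMap R A) = maximalIdeal A)
    (C : MinFreeRes R (ResidueField R)) :
    ∃ (b : ℕ → ℕ) (d : ∀ n, (Fin (b (n + 1)) → A) →ₗ[A] (Fin (b n) → A)),
      (∀ n, b n = Module.finrank R (C.F n)) ∧
      (∀ n v, d n v ∈ maximalIdeal A • (⊤ : Submodule A (Fin (b n) → A))) ∧
      (∀ n v, d n (d (n + 1) v) = 0) ∧ (∀ n v, d n v = 0 → ∃ w, v = d (n + 1) w) ∧
      (∀ v ∈ maximalIdeal A • (⊤ : Submodule A (Fin (b 0) → A)), ∃ w, v = d 0 w) := by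
  let b : ℕ → ℕ := fun n => Module.finrank R (C.F n)
  have hfree := C.free
  have hfin := C.fin
  let e : ∀ n, A ⊗[R] C.F n ≃ₗ[A] (Fin (b n) → A) := fun n =>
    ((Module.finBasis R (C.F n)).baseChange A).equivFun
  let D : ∀ n, A ⊗[R] C.F (n + 1) →ₗ[A] A ⊗[R] C.F n := fun n => (C.d n).baseChange A
  let d : ∀ n, (Fin (b (n + 1)) → A) →ₗ[A] (Fin (b n) → A) := fun n =>
    (e n).toLinearMap ∘ₗ D n ∘ₗ (e (n + 1)).symm.toLinearMap
  have hex : ∀ n, Function.Exact (D (n + 1)) (D n) := fun n =>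
    Module.Flat.lTensor_exact A (LinearMap.exact_iff.mpr (C.exact n))
  have hmem : ∀ (n : ℕ) (x : C.F n), x ∈ maximalIdeal R • (⊤ : Submodule R (C.F n)) →
      (1 : A) ⊗ₜ[R] x ∈ maximalIdeal A • (⊤ : Submodule A (A ⊗[R] C.F n)) := by
    intro n x hx
    refine Submodule.smul_induction_on hx (fun r hr y _ => ?_) (fun y z hy hz => ?_)
    · rw [TensorProduct.tmul_smul, ← algebraMap_smul A r ((1 : A) ⊗ₜ[R] y)]
      refine Submodule.smul_mem_smul ?_ trivial
      rw [← hm]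
      exact Ideal.mem_map_of_mem _ hr
    · rw [TensorProduct.tmul_add]
      exact add_mem hy hz
  have hmin : ∀ n v, D n v ∈ maximalIdeal A • (⊤ : Submodule A (A ⊗[R] C.F n)) := by
    intro n v
    induction v with
    | zero => rw [map_zero]; exact zero_mem _
    | add x y hx hy => rw [map_add]; exact add_mem hx hy
    | tmul a x =>
      have h : a ⊗ₜ[R] x = a • ((1 : A) ⊗ₜ[R] x) := by simp [TensorProduct.smul_tmul']
      rw [h, map_smul]
      exact Submodule.smul_mem _ _ (hmem n _ (C.minimal n ⟨x, rfl⟩))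
  have hmin₀ : ∀ v ∈ maximalIdeal A • (⊤ : Submodule A (A ⊗[R] C.F 0)), ∃ w, v = D 0 w := by
    intro v hv
    rw [← hm] at hv
    suffices h : (maximalIdeal R).map (algebraMap R A) • (⊤ : Submodule A (A ⊗[R] C.F 0)) ≤
        LinearMap.range (D 0) by
      obtain ⟨w, hw⟩ := h hv
      exact ⟨w, hw.symm⟩
    rw [Submodule.smul_le]
    intro r hr x _
    refine Submodule.span_induction (p := fun r _ => r • x ∈ LinearMap.range (D 0))
      ?_ ?_ ?_ ?_ hr
    · rintro _ ⟨r, hr, rfl⟩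
      rw [algebraMap_smul]
      induction x with
      | zero => rw [smul_zero]; exact zero_mem _
      | add x y hx hy => rw [smul_add]; exact add_mem (hx trivial) (hy trivial)
      | tmul a x =>
        rw [← TensorProduct.tmul_smul]
        have h : r • x ∈ LinearMap.ker C.aug := by
          rw [LinearMap.mem_ker, map_smul]
          obtain ⟨s, hs⟩ := residue_surjective (C.aug x)
          rw [← hs, ← ResidueField.algebraMap_eq, Algebra.smul_def, ← map_mul,
            ResidueField.algebraMap_eq, residue_eq_zero_iff]
          exact Ideal.mul_mem_right _ _ hr
        rw [C.exact_aug] at h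
        obtain ⟨y, hy⟩ := h
        exact ⟨a ⊗ₜ y, by rw [← hy]; rfl⟩
    · rw [zero_smul]; exact zero_mem _
    · intro r s _ _ hr hs
      rw [add_smul]; exact add_mem hr hs
    · intro c r _ hr
      rw [smul_assoc]; exact Submodule.smul_mem _ c hr
  refine ⟨b, d, fun _ => rfl, fun n v => ?_, fun n v => ?_, fun n v hv => ?_, fun v hv => ?_⟩
  · exact map_mem_smul (e n).toLinearMap (Q := ⊤) (fun _ _ => trivial) (hmin n _)
  · simp only [d, LinearMap.comp_apply, LinearEquiv.coe_coe, LinearEquiv.symm_apply_apply]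
    rw [(hex n).apply_apply_eq_zero, map_zero]
  · simp only [d, LinearMap.comp_apply, LinearEquiv.coe_coe, LinearEquiv.map_eq_zero_iff] at hv
    obtain ⟨w, hw⟩ := (hex n _).mp hv
    refine ⟨e (n + 2) w, ?_⟩
    simp only [d, LinearMap.comp_apply, LinearEquiv.coe_coe, LinearEquiv.symm_apply_apply]
    rw [hw, LinearEquiv.apply_symm_apply]
  · obtain ⟨w, hw⟩ := hmin₀ _ (map_mem_smul (e 0).symm.toLinearMap (Q := ⊤)
      (fun _ _ => trivial) hv)
    refine ⟨e 1 w, ?_⟩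
    simp only [d, LinearMap.comp_apply, LinearEquiv.coe_coe, LinearEquiv.symm_apply_apply]
    rw [← hw]
    simp

/-- Two elements of a non-principal ideal of a local ring that are independent modulo `𝔪 I`. -/
theorem exists_independent_of_not_isPrincipal {S : Type} [CommRing S] [IsLocalRing S]
    [IsNoetherianRing S] {I : Ideal S} (hI : ¬ I.IsPrincipal) :
    ∃ f₁ ∈ I, ∃ f₂ ∈ I, ∀ x y, f₁ * x + f₂ * y ∈ maximalIdeal S * I →
      x ∈ maximalIdeal S ∧ y ∈ maximalIdeal S := by
  have hfg : I.FG := IsNoetherian.noetherian I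
  have hle : ∀ f ∈ I, ¬ I ≤ Ideal.span {f} ⊔ maximalIdeal S • I := fun f hf hle => hI ⟨f, by
    refine le_antisymm ?_ ((Ideal.span_singleton_le_iff_mem _).mpr hf)
    exact Submodule.le_of_le_smul_of_le_jacobson_bot hfg (maximalIdeal_le_jacobson _) hle⟩
  obtain ⟨f₁, hf₁, h₁⟩ := SetLike.not_le_iff_exists.mp (hle 0 (zero_mem _))
  obtain ⟨f₂, hf₂, h₂⟩ := SetLike.not_le_iff_exists.mp (hle f₁ hf₁)
  rw [smul_eq_mul, Submodule.mem_sup] at h₂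
  have h₁' : f₁ ∉ maximalIdeal S * I := fun h => h₁ (Submodule.mem_sup_right h)
  have hunit : ∀ z, z ∉ maximalIdeal S → ∃ u, u * z = 1 := fun z hz => by
    have : IsUnit z := by simpa using hz
    exact this.exists_left_inv
  have hy : ∀ x y, f₁ * x + f₂ * y ∈ maximalIdeal S * I → y ∈ maximalIdeal S := by
    intro x y h
    by_contra hy
    obtain ⟨u, hu⟩ := hunit y hy
    refine h₂ ⟨f₁ * (-(u * x)), Ideal.mul_mem_right _ _ (Ideal.mem_span_singleton_self _),
      u * (f₁ * x + f₂ * y), Ideal.mul_mem_left _ _ h, ?_⟩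
    linear_combination f₂ * hu
  refine ⟨f₁, hf₁, f₂, hf₂, fun x y h => ⟨?_, hy x y h⟩⟩
  by_contra hx
  obtain ⟨u, hu⟩ := hunit x hx
  refine h₁' ?_
  have : f₁ = u * (f₁ * x + f₂ * y) - u * (y * f₂) := by linear_combination -f₁ * hu
  rw [this]
  exact sub_mem (Ideal.mul_mem_left _ _ h)
    (Ideal.mul_mem_left _ _ (Ideal.mul_mem_mul (hy x y h) hf₂))

/-- Over a quotient of a local ring `S` by an ideal inside the square of the maximal ideal, bounded
Betti numbers of the residue field force that ideal to be principal. -/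
theorem isPrincipal_ker_of_bounded {S A : Type} [CommRing S] [IsLocalRing S] [IsNoetherianRing S]
    [CommRing A] [IsLocalRing A] (π : S →+* A) (hπ : Function.Surjective π)
    (hker : RingHom.ker π ≤ maximalIdeal S * maximalIdeal S)
    {b : ℕ → ℕ} {d : ∀ n, (Fin (b (n + 1)) → A) →ₗ[A] (Fin (b n) → A)}
    (hd : ∀ n v, d n v ∈ maximalIdeal A • (⊤ : Submodule A (Fin (b n) → A)))
    (hdd : ∀ n v, d n (d (n + 1) v) = 0)
    (hexact : ∀ n v, d n v = 0 → ∃ w, v = d (n + 1) w)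
    (hexact₀ : ∀ v ∈ maximalIdeal A • (⊤ : Submodule A (Fin (b 0) → A)), ∃ w, v = d 0 w)
    (hb : 0 < b 0) {B : ℕ} (hB : ∀ n, b n ≤ B) : (RingHom.ker π).IsPrincipal := by
  by_contra hI
  obtain ⟨f₁, hf₁, f₂, hf₂, hind⟩ := exists_independent_of_not_isPrincipal hI
  obtain ⟨K⟩ := KoszulData.nonempty_of_mem_mul (hker hf₁) (hker hf₂)
  have hmax : ∀ x, π x ∈ maximalIdeal A ↔ x ∈ maximalIdeal S := by
    have := IsLocalRing.of_surjective' π hπ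
    have := hπ.isLocalHom
    intro x
    simp
  let p : ∀ n, (Fin (b n) → S) → (Fin (b n) → A) := fun n v i => π (v i)
  have hp : ∀ n, Function.Surjective (p n) := fun n v => by
    choose s hs using fun i => hπ (v i)
    exact ⟨s, funext hs⟩
  have lift : ∀ n, ∃ δ : (Fin (b (n + 1)) → S) →ₗ[S] (Fin (b n) → S),
      ∀ v, p n (δ v) = d n (p (n + 1) v) := by
    intro n
    choose m hm using fun (i : Fin (b (n + 1))) => hp n (d n (Pi.single i 1))
    refine ⟨Fintype.linearCombination S m, fun v => ?_⟩
    have h1 : p (n + 1) v = ∑ i, π (v i) • (Pi.single i 1 : Fin (b (n + 1)) → A) := by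
      funext j
      simp [p, Finset.sum_apply, Pi.single_apply]
    rw [h1, map_sum]
    funext j
    simp only [Fintype.linearCombination_apply, p, Finset.sum_apply, map_sum, map_smul,
      Pi.smul_apply, smul_eq_mul, map_mul, ← hm]
  choose δ hδ using lift
  have hzero : ∀ n v, p n v = 0 ↔ v ∈ RingHom.ker π • (⊤ : Submodule S (Fin (b n) → S)) := by
    intro n v
    rw [mem_smul_top_pi_iff, funext_iff]
    rfl
  have hmem : ∀ n v, p n v ∈ maximalIdeal A • (⊤ : Submodule A (Fin (b n) → A)) ↔
      v ∈ maximalIdeal S • (⊤ : Submodule S (Fin (b n) → S)) := by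
    intro n v
    simp only [mem_smul_top_pi_iff, p, hmax]
  have hsub : ∀ n v w, p n (v - w) = p n v - p n w := fun n v w => by
    funext i
    simp [p]
  have h := lt_of_resolution_mod (d := δ) hf₁ hf₂ hind K.tate
    (fun n v => by rw [← hmem, hδ]; exact hd n _)
    (fun n v => by rw [← hzero, hδ, hδ, hdd])
    (fun n v hv => by
      rw [← hzero, hδ] at hv
      obtain ⟨w, hw⟩ := hexact n _ hv
      obtain ⟨w', rfl⟩ := hp _ w
      exact ⟨w', by rw [← hzero, hsub, hδ, hw, sub_self]⟩)
    (fun v hv => by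
      rw [← hmem] at hv
      obtain ⟨w, hw⟩ := hexact₀ _ hv
      obtain ⟨w', rfl⟩ := hp _ w
      exact ⟨w', by rw [← hzero, hsub, hδ, hw, sub_self]⟩) hb B
  exact absurd (hB (2 * B)) (by omega)

end Transfer

section FormallySmoothField

/-- Infinitesimal criterion for the formal smoothness of a field extension in terms of polynomial
relations. -/
theorem formallySmooth_field_iff (K L : Type) [Field K] [Field L] [Algebra K L] :
    Algebra.FormallySmooth K L ↔ ∀ x : MvPolynomial L K, MvPolynomial.aeval (id : L → L) x = 0 →
      (∀ a, MvPolynomial.aeval (id : L → L) (MvPolynomial.pderiv a x) = 0) →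
      x ∈ RingHom.ker (MvPolynomial.aeval (R := K) (id : L → L)) ^ 2 := by
  let alg : Algebra (MvPolynomial L K) L := (MvPolynomial.aeval (R := K) (id : L → L)).toAlgebra
  have tower : IsScalarTower K (MvPolynomial L K) L := IsScalarTower.of_algebraMap_eq fun x =>
    (AlgHom.commutes (MvPolynomial.aeval (R := K) (id : L → L)) x).symm
  have hsurj : Function.Surjective (algebraMap (MvPolynomial L K) L) := fun a =>
    ⟨MvPolynomial.X a, MvPolynomial.aeval_X _ _⟩
  have key : ∀ x : RingHom.ker (algebraMap (MvPolynomial L K) L),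
      KaehlerDifferential.kerCotangentToTensor K (MvPolynomial L K) L (Ideal.toCotangent _ x) = 0 ↔
      ∀ a, MvPolynomial.aeval (id : L → L) (MvPolynomial.pderiv a x.1) = 0 := by
    intro x
    rw [KaehlerDifferential.kerCotangentToTensor_toCotangent,
      ← ((KaehlerDifferential.mvPolynomialBasis K L).baseChange L).repr.map_eq_zero_iff,
      Finsupp.ext_iff]
    refine forall_congr' fun a => ?_
    rw [Module.Basis.baseChange_repr_tmul, KaehlerDifferential.mvPolynomialBasis_repr_apply,
      Algebra.smul_def, mul_one]
    rfl
  have h1 : Algebra.FormallySmooth K L ↔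
      Function.Injective (KaehlerDifferential.kerCotangentToTensor K (MvPolynomial L K) L) := by
    rw [Algebra.FormallySmooth.kerCotangentToTensor_injective_iff hsurj,
      Algebra.formallySmooth_iff, and_iff_right]
    infer_instance
  rw [h1, injective_iff_map_eq_zero]
  constructor
  · intro h x hx hx'
    exact (Ideal.toCotangent_eq_zero _ ⟨x, hx⟩).mp (h _ ((key ⟨x, hx⟩).mpr hx'))
  · intro h c hc
    obtain ⟨x, rfl⟩ := Ideal.toCotangent_surjective _ c
    exact (Ideal.toCotangent_eq_zero _ x).mpr (h x.1 x.2 ((key x).mp hc))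

theorem formallySmooth_of_perfectField (K L : Type) [Field K] [Field L] [Algebra K L]
    [PerfectField K] : Algebra.FormallySmooth K L := by
  rw [formallySmooth_field_iff]
  intro x hx hx'
  classical
  let M : IntermediateField K L := IntermediateField.adjoin K (x.vars : Set L)
  have hM : Algebra.EssFiniteType K M := by
    rw [IntermediateField.essFiniteType_iff]
    exact ⟨x.vars, rfl⟩
  have hsm : Algebra.FormallySmooth K M := inferInstance
  rw [formallySmooth_field_iff] at hsm
  obtain ⟨y, hy⟩ := MvPolynomial.exists_rename_eq_of_vars_subset_range x (Subtype.val : M → L)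
    Subtype.val_injective (fun a ha =>
      ⟨⟨a, IntermediateField.subset_adjoin _ _ (Finset.mem_coe.mpr ha)⟩, rfl⟩)
  have hval : ∀ z : MvPolynomial M K, MvPolynomial.aeval (id : L → L)
      (MvPolynomial.rename (Subtype.val : M → L) z) =
      M.val (MvPolynomial.aeval (id : M → M) z) := by
    intro z
    rw [MvPolynomial.aeval_rename, ← AlgHom.comp_apply, MvPolynomial.comp_aeval]
    rfl
  have hinj : ∀ z : MvPolynomial M K, MvPolynomial.aeval (id : L → L)
      (MvPolynomial.rename (Subtype.val : M → L) z) = 0 →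
      MvPolynomial.aeval (id : M → M) z = 0 := fun z hz => by
    rw [hval] at hz
    exact (map_eq_zero_iff _ M.val.injective).mp hz
  have h := hsm y (hinj y (by rw [hy, hx])) fun a => hinj _ (by
    rw [← MvPolynomial.pderiv_rename Subtype.val_injective, hy, hx'])
  rw [← hy]
  have hle : Ideal.map (MvPolynomial.rename (R := K) (Subtype.val : M → L))
      (RingHom.ker (MvPolynomial.aeval (R := K) (id : M → M))) ≤
      RingHom.ker (MvPolynomial.aeval (R := K) (id : L → L)) := by
    rw [Ideal.map_le_iff_le_comap]
    intro z hz
    rw [RingHom.mem_ker] at hz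
    rw [Ideal.mem_comap, RingHom.mem_ker, hval, hz, map_zero]
  refine Ideal.pow_right_mono hle 2 ?_
  rw [← Ideal.map_pow]
  exact Ideal.mem_map_of_mem _ h

end FormallySmoothField

section Lifting

/-- A ring in which a prime `p` is a regular element generating a maximal ideal has the lifting
property for square-zero extensions whose kernel is killed by `p`. -/
theorem exists_lift_of_sq_zero {p : ℕ} [Fact p.Prime] {C B B' : Type} [CommRing C] [CommRing B]
    [CommRing B'] (hp : ∀ c : C, p * c = 0 → c = 0) (hmax : (Ideal.span {(p : C)}).IsMaximal)
    (q : B →+* B') (hq : Function.Surjective q) (hJ : ∀ x y, q x = 0 → q y = 0 → x * y = 0)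
    (hpJ : ∀ x, q x = 0 → p * x = 0) (h : C →+* B') : ∃ g : C →+* B, q.comp g = h := by
  let E : Subring (C × B) := RingHom.eqLocus (h.comp (RingHom.fst C B)) (q.comp (RingHom.snd C B))
  have hE : ∀ e : E, h e.1.1 = q e.1.2 := fun e => e.2
  let pr : E →+* C := (RingHom.fst C B).comp E.subtype
  have hpr : Function.Surjective pr := fun c => by
    obtain ⟨b, hb⟩ := hq (h c)
    exact ⟨⟨(c, b), hb.symm⟩, rfl⟩
  have hpcast : ∀ e : E, pr (p * e) = p * pr e := fun e => by rw [map_mul, map_natCast]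
  let k := C ⧸ Ideal.span {(p : C)}
  let _ : Field k := Ideal.Quotient.field _
  let E' := E ⧸ Ideal.span {(p : E)}
  have hp0 : ((p : ℕ) : E') = 0 := by
    rw [← map_natCast (Ideal.Quotient.mk (Ideal.span {(p : E)})), Ideal.Quotient.eq_zero_iff_mem]
    exact Ideal.mem_span_singleton_self _
  let z : ZMod p →+* E' := (Ideal.Quotient.lift (Ideal.span {(p : ℤ)}) (Int.castRingHom E') (by
    intro a ha
    obtain ⟨b, rfl⟩ := Ideal.mem_span_singleton.mp ha
    simp [hp0])).comp (Int.quotientSpanNatEquivZMod p).symm.toRingHom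
  let prbar : E' →+* k := Ideal.quotientMap (Ideal.span {(p : C)}) pr (by
    rw [Ideal.span_singleton_le_iff_mem, Ideal.mem_comap, map_natCast]
    exact Ideal.mem_span_singleton_self _)
  have hprbar : ∀ e, prbar (Ideal.Quotient.mk _ e) = Ideal.Quotient.mk _ (pr e) := fun e => rfl
  let _ : Algebra (ZMod p) E' := z.toAlgebra
  let _ : Algebra (ZMod p) k := (prbar.comp z).toAlgebra
  let prA : E' →ₐ[ZMod p] k := { prbar with commutes' := fun _ => rfl }
  have hprA : Function.Surjective prA := fun x => by
    obtain ⟨c, rfl⟩ := Ideal.Quotient.mk_surjective x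
    obtain ⟨e, rfl⟩ := hpr c
    exact ⟨Ideal.Quotient.mk _ e, rfl⟩
  have hker : ∀ e' : E', prA e' = 0 → ∃ e : E, pr e = 0 ∧ Ideal.Quotient.mk _ e = e' := by
    intro e' he'
    obtain ⟨e, rfl⟩ := Ideal.Quotient.mk_surjective e'
    have h1 : Ideal.Quotient.mk (Ideal.span {(p : C)}) (pr e) = 0 := he'
    obtain ⟨c, hc⟩ := Ideal.mem_span_singleton.mp (Ideal.Quotient.eq_zero_iff_mem.mp h1)
    obtain ⟨e₁, rfl⟩ := hpr c
    refine ⟨e - p * e₁, by rw [map_sub, hpcast, hc, sub_self], ?_⟩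
    rw [map_sub, map_mul, map_natCast, hp0, zero_mul, sub_zero]
  have hq0 : ∀ e : E, pr e = 0 → q e.1.2 = 0 := fun e he => by
    rw [← hE e]
    exact (congrArg h he).trans (map_zero h)
  have hsq : ∀ e₁ e₂ : E, pr e₁ = 0 → pr e₂ = 0 → e₁ * e₂ = 0 := fun e₁ e₂ h₁ h₂ =>
    Subtype.ext (Prod.ext ((congrArg (· * pr e₂) h₁).trans (zero_mul _))
      (hJ _ _ (hq0 e₁ h₁) (hq0 e₂ h₂)))
  have hnil : IsNilpotent (RingHom.ker prA) := by
    refine ⟨2, (pow_two (RingHom.ker prA)).trans (eq_bot_iff.mpr (Ideal.mul_le.mpr ?_))⟩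
    intro x hx y hy
    obtain ⟨e₁, h₁, rfl⟩ := hker x hx
    obtain ⟨e₂, h₂, rfl⟩ := hker y hy
    rw [← map_mul, hsq _ _ h₁ h₂, map_zero]
    exact zero_mem _
  have hsmooth : Algebra.FormallySmooth (ZMod p) k := formallySmooth_of_perfectField (ZMod p) k
  let s : k →ₐ[ZMod p] E' :=
    Algebra.FormallySmooth.liftOfSurjective (AlgHom.id (ZMod p) k) prA hprA hnil
  have hs : ∀ x, prA (s x) = x := fun x =>
    Algebra.FormallySmooth.liftOfSurjective_apply (AlgHom.id (ZMod p) k) prA hprA hnil x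
  let σ : E →+* E' := s.toRingHom.comp ((Ideal.Quotient.mk _).comp pr)
  let D : Subring E := RingHom.eqLocus (Ideal.Quotient.mk (Ideal.span {(p : E)})) σ
  have hD : ∀ e : D, Ideal.Quotient.mk (Ideal.span {(p : E)}) e.1 = s (Ideal.Quotient.mk _ (pr e.1)) :=
    fun e => e.2
  let t : D →+* C := pr.comp D.subtype
  have ht : Function.Bijective t := by
    constructor
    · rw [injective_iff_map_eq_zero]
      intro e he
      have he' : pr e.1 = 0 := he
      have h1 := hD e
      rw [he', map_zero, map_zero, Ideal.Quotient.eq_zero_iff_mem, Ideal.mem_span_singleton] at h1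
      obtain ⟨e₁, h1⟩ := h1
      have h2 : pr e₁ = 0 := hp _ (by rw [← hpcast, ← h1, he'])
      have h3 : p * e₁ = 0 := Subtype.ext (Prod.ext ((hpcast e₁).trans (by rw [h2, mul_zero]; rfl))
        (hpJ _ (hq0 e₁ h2)))
      exact Subtype.ext (h1.trans h3)
    · intro c
      obtain ⟨e, rfl⟩ := hpr c
      obtain ⟨e₁, h1, h2⟩ := hker (Ideal.Quotient.mk _ e - s (Ideal.Quotient.mk _ (pr e))) (by
        rw [map_sub, hs]
        exact sub_self _)
      have h3 : pr (e - e₁) = pr e := by rw [map_sub, h1, sub_zero]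
      refine ⟨⟨e - e₁, ?_⟩, h3⟩
      change Ideal.Quotient.mk (Ideal.span {(p : E)}) (e - e₁) = s (Ideal.Quotient.mk _ (pr (e - e₁)))
      rw [h3, map_sub, h2, sub_sub_cancel]
  let eq := RingEquiv.ofBijective t ht
  refine ⟨(RingHom.snd C B).comp (E.subtype.comp (D.subtype.comp eq.symm.toRingHom)), ?_⟩
  ext c
  have h1 : t (eq.symm c) = c := eq.apply_symm_apply c
  exact (hE (eq.symm c).1).symm.trans (congrArg h h1)

/-- Lifting of the residue map of a complete local ring. -/
theorem exists_lift_of_adic {C A : Type} [CommRing C] [CommRing A] (I : Ideal A) [IsAdicComplete I A]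
    (hlift : ∀ n, ∀ h : C →+* A ⧸ I ^ (n + 1), ∃ g : C →+* A ⧸ I ^ (n + 2),
      (Ideal.Quotient.factorPow I (n + 1).le_succ).comp g = h)
    (h : C →+* A ⧸ I) : ∃ g : C →+* A, (Ideal.Quotient.mk I).comp g = h := by
  have h1 : I = I ^ (0 + 1) := by rw [zero_add, pow_one]
  choose φ hφ using hlift
  let F : ∀ n : ℕ, C →+* A ⧸ I ^ (n + 1) := fun n =>
    Nat.rec ((Ideal.quotEquivOfEq h1).toRingHom.comp h) (fun n g => φ n g) n
  have hF : ∀ n, (Ideal.Quotient.factorPow I (n + 1).le_succ).comp (F (n + 1)) = F n := fun n =>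
    hφ n (F n)
  have ha : StrictMono (fun n : ℕ => n + 1) := strictMono_nat_of_lt_succ fun n => Nat.lt_succ_self _
  refine ⟨IsAdicComplete.StrictMono.liftRingHom I ha F (fun {n} => hF n), ?_⟩
  ext c
  have := IsAdicComplete.StrictMono.mk_liftRingHom I ha F (fun {n} => hF n) (n := 0) c
  apply (Ideal.quotEquivOfEq h1).injective
  exact this

end Lifting

section CohenRing

open Polynomial

/-- Every field of positive characteristic embeds in the residue field of a domain of
characteristic zero, local and absolutely integrally closed. -/
theorem exists_local_domain_splitting (p : ℕ) (k : Type) [Field k] [CharP k p] :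
    ∃ (O : Type) (_ : CommRing O) (_ : IsDomain O) (_ : IsLocalRing O) (_ : CharZero O)
      (_ : k →+* ResidueField O), (p : O) ∈ maximalIdeal O ∧ ∀ f : O[X], f.Monic → f.Splits := by
  let D := MvPolynomial k ℤ
  let φ : D →+* k := MvPolynomial.eval₂Hom (Int.castRingHom k) id
  have hφ : Function.Surjective φ := fun x => ⟨MvPolynomial.X x, MvPolynomial.eval₂_X _ _ _⟩
  let Ω := AlgebraicClosure (FractionRing D)
  let j : D →+* Ω := (algebraMap (FractionRing D) Ω).comp (algebraMap D (FractionRing D))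
  have hj : Function.Injective j :=
    (algebraMap (FractionRing D) Ω).injective.comp (IsFractionRing.injective D (FractionRing D))
  let e : D ≃+* j.range := RingEquiv.ofLeftInverse (Function.leftInverse_invFun hj)
  let I : Ideal j.range := (RingHom.ker φ).comap e.symm.toRingHom
  have hI : I ≠ ⊤ := Ideal.comap_ne_top _ (RingHom.ker_ne_top φ)
  obtain ⟨V, hV, hIV⟩ := Ideal.image_subset_nonunits_valuationSubring I hI
  let i : D →+* V := (Subring.inclusion hV).comp e.toRingHom
  have hi : Function.Injective i := (Subring.inclusion_injective hV).comp e.injective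
  have hmem : ∀ x ∈ RingHom.ker φ, i x ∈ maximalIdeal V := by
    intro x hx
    have h1 : (i x : Ω) ∈ V.nonunits := hIV ⟨e x, by
      change e.symm (e x) ∈ RingHom.ker φ
      rwa [e.symm_apply_apply], rfl⟩
    rw [← SetLike.mem_coe, ← V.image_maximalIdeal] at h1
    obtain ⟨y, hy, hyx⟩ := h1
    rwa [← Subtype.ext hyx]
  have hclosed : IsIntegrallyClosed V := inferInstance
  refine ⟨V, inferInstance, inferInstance, inferInstance, charZero_of_injective_ringHom hi,
    (Ideal.Quotient.lift (RingHom.ker φ) ((residue V).comp i) fun x hx =>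
      (residue_eq_zero_iff _).mpr (hmem x hx)).comp
      (RingHom.quotientKerEquivOfSurjective hφ).symm.toRingHom, ?_, ?_⟩
  · have h1 := hmem (p : D) (by rw [RingHom.mem_ker, map_natCast, CharP.cast_eq_zero])
    rwa [map_natCast] at h1
  · intro f hf
    have h1 : (f.map (algebraMap V Ω)).Splits := IsAlgClosed.splits _
    refine Splits.of_splits_map_of_injective (i := algebraMap V Ω)
      (FaithfulSMul.algebraMap_injective V Ω) h1 ?_
    intro a ha
    rw [RingHom.mem_range]
    refine IsIntegrallyClosed.isIntegral_iff.mp ⟨f, hf, ?_⟩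
    rw [← Polynomial.eval_map]
    exact (mem_roots'.mp ha).2

section Saturated

variable {O : Type} [CommRing O] [IsLocalRing O] {p : ℕ}

/-- A subring of a local ring `O` over which `p` generates the trace of the maximal ideal. -/
def IsPSaturated (p : ℕ) (C : Subring O) : Prop :=
  ∀ c ∈ C, c ∈ maximalIdeal O → ∃ c' ∈ C, c = p * c'

variable {k : Type} [Field k] (ι : k →+* ResidueField O)

/-- The subrings that `p` saturates and whose residues lie in a given subfield. -/
def saturatedSubrings (p : ℕ) : Set (Subring O) :=
  {C | IsPSaturated p C ∧ ∀ c ∈ C, residue O c ∈ ι.range}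

theorem exists_maximal_saturated (hp : p.Prime) (hpO : (p : O) ∈ maximalIdeal O) :
    ∃ C, Maximal (· ∈ saturatedSubrings ι p) C := by
  have h0 : (Int.castRingHom O).range ∈ saturatedSubrings ι p := by
    constructor
    · rintro _ ⟨n, rfl⟩ hn
      by_cases hd : (p : ℤ) ∣ n
      · obtain ⟨m, rfl⟩ := hd
        exact ⟨m, ⟨m, rfl⟩, by simp⟩
      · exfalso
        obtain ⟨u, v, huv⟩ := ((Nat.prime_iff_prime_int.mp hp).irreducible.coprime_iff_not_dvd).mpr hd
        apply (Ideal.ne_top_iff_one _).mp (maximalIdeal.isMaximal O).ne_top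
        have h1 : (u : O) * p + v * (Int.castRingHom O n) = 1 := by
          rw [eq_intCast]
          exact_mod_cast congrArg (Int.cast : ℤ → O) huv
        rw [← h1]
        exact add_mem (Ideal.mul_mem_left _ _ hpO) (Ideal.mul_mem_left _ _ hn)
    · rintro _ ⟨n, rfl⟩
      exact ⟨n, by simp⟩
  obtain ⟨C, -, hC⟩ := zorn_le_nonempty₀ (saturatedSubrings ι p) (fun c hc hchain y hy => by
    have hmem : ∀ x, x ∈ sSup c ↔ ∃ s ∈ c, x ∈ s := fun x =>
      Subring.mem_sSup_of_directedOn ⟨y, hy⟩ hchain.directedOn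
    refine ⟨sSup c, ⟨?_, ?_⟩, fun z hz => le_sSup hz⟩
    · intro x hx hxm
      obtain ⟨s, hs, hxs⟩ := (hmem x).mp hx
      obtain ⟨x', hx', h⟩ := (hc hs).1 x hxs hxm
      exact ⟨x', (hmem x').mpr ⟨s, hs, hx'⟩, h⟩
    · intro x hx
      obtain ⟨s, hs, hxs⟩ := (hmem x).mp hx
      exact (hc hs).2 x hxs) _ h0
  exact ⟨C, hC⟩

variable {ι} {C : Subring O}

theorem Maximal.exists_mul_eq_one (hC : Maximal (· ∈ saturatedSubrings ι p) C) {s : O} (hs : s ∈ C)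
    (hsm : s ∉ maximalIdeal O) : ∃ t ∈ C, s * t = 1 := by
  have hu : ∀ t ∉ maximalIdeal O, IsUnit t := fun t ht => by simpa using ht
  let E : Subring O :=
    { carrier := {x | ∃ c ∈ C, ∃ s ∈ C, s ∉ maximalIdeal O ∧ s * x = c}
      mul_mem' := by
        rintro x y ⟨c, hc, s, hs, hsm, h⟩ ⟨c', hc', s', hs', hsm', h'⟩
        refine ⟨c * c', mul_mem hc hc', s * s', mul_mem hs hs', ?_, by rw [← h, ← h']; ring⟩
        exact fun hm => ((maximalIdeal.isMaximal O).isPrime.mem_or_mem hm).elim hsm hsm'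
      one_mem' := ⟨1, one_mem _, 1, one_mem _, by simp, by simp⟩
      add_mem' := by
        rintro x y ⟨c, hc, s, hs, hsm, h⟩ ⟨c', hc', s', hs', hsm', h'⟩
        refine ⟨s' * c + s * c', add_mem (mul_mem hs' hc) (mul_mem hs hc'), s * s', mul_mem hs hs',
          ?_, by rw [← h, ← h']; ring⟩
        exact fun hm => ((maximalIdeal.isMaximal O).isPrime.mem_or_mem hm).elim hsm hsm'
      zero_mem' := ⟨0, zero_mem _, 1, one_mem _, by simp, by simp⟩
      neg_mem' := by
        rintro x ⟨c, hc, s, hs, hsm, h⟩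
        exact ⟨-c, neg_mem hc, s, hs, hsm, by rw [← h]; ring⟩ }
  have hCE : C ≤ E := fun x hx => ⟨x, hx, 1, one_mem _, by simp, by simp⟩
  have hE : E ∈ saturatedSubrings ι p := by
    constructor
    · rintro x ⟨c, hc, s, hs, hsm, h⟩ hx
      obtain ⟨c', hc', h'⟩ := hC.prop.1 c hc (by rw [← h]; exact Ideal.mul_mem_left _ _ hx)
      obtain ⟨t, ht⟩ := (hu s hsm).exists_right_inv
      refine ⟨c' * t, ⟨c', hc', s, hs, hsm, by rw [mul_left_comm, ht, mul_one]⟩, ?_⟩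
      rw [← mul_assoc, ← h', ← h, mul_right_comm, ht, one_mul]
    · rintro x ⟨c, hc, s, hs, hsm, h⟩
      obtain ⟨a, ha⟩ := hC.prop.2 c hc
      obtain ⟨b, hb⟩ := hC.prop.2 s hs
      have hs0 : residue O s ≠ 0 := fun h0 => hsm ((residue_eq_zero_iff _).mp h0)
      refine ⟨a / b, ?_⟩
      rw [map_div₀, ha, hb, ← h, map_mul, mul_div_cancel_left₀ _ hs0]
  obtain ⟨t, ht⟩ := (hu s hsm).exists_right_inv
  exact ⟨t, hC.le_of_ge hE hCE ⟨1, one_mem _, s, hs, hsm, ht⟩, ht⟩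

/-- A relation over a saturated subring can be made monic without raising the degree. -/
theorem Maximal.exists_monic (hC : Maximal (· ∈ saturatedSubrings ι p) C) (α : ResidueField O)
    (g : C[X]) (h0 : g.map ((residue O).comp C.subtype) ≠ 0)
    (hα : g.eval₂ ((residue O).comp C.subtype) α = 0) :
    ∃ f : C[X], f.Monic ∧ f.natDegree ≤ g.natDegree ∧
      f.eval₂ ((residue O).comp C.subtype) α = 0 := by
  induction hn : g.natDegree using Nat.strong_induction_on generalizing g with
  | _ n ih =>
  by_cases hl : (g.leadingCoeff : O) ∈ maximalIdeal O
  · have hl0 : (residue O).comp C.subtype g.leadingCoeff = 0 := (residue_eq_zero_iff _).mpr hl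
    have hg0 : g.natDegree ≠ 0 := fun hd => h0 (by
      rw [eq_C_of_natDegree_eq_zero hd, Polynomial.map_C, C_eq_zero]
      rwa [leadingCoeff, hd] at hl0)
    have hsum := g.eraseLead_add_monomial_natDegree_leadingCoeff
    have h1 : g.eraseLead.map ((residue O).comp C.subtype) = g.map ((residue O).comp C.subtype) := by
      conv_rhs => rw [← hsum]
      rw [Polynomial.map_add, map_monomial, hl0, monomial_zero_right, add_zero]
    have hlt : g.eraseLead.natDegree < n := by
      have := g.eraseLead_natDegree_le
      omega
    obtain ⟨f, hf, hfd, hfα⟩ := ih _ hlt g.eraseLead (by rwa [h1]) (by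
      rw [← Polynomial.eval_map, h1, Polynomial.eval_map, hα]) rfl
    exact ⟨f, hf, hfd.trans hlt.le, hfα⟩
  · obtain ⟨t, ht, hgt⟩ := hC.exists_mul_eq_one g.leadingCoeff.2 hl
    have h1 : g.leadingCoeff * (⟨t, ht⟩ : C) = 1 := Subtype.ext hgt
    refine ⟨g * Polynomial.C ⟨t, ht⟩, monic_mul_C_of_leadingCoeff_mul_eq_one h1, ?_, ?_⟩
    · rw [← hn]
      exact natDegree_mul_C_le _ _
    · rw [eval₂_mul, hα, zero_mul]

theorem Maximal.exists_lift [IsDomain O] (hC : Maximal (· ∈ saturatedSubrings ι p) C)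
    (hsplit : ∀ f : O[X], f.Monic → f.Splits) (α : ResidueField O) :
    ∃ a : O, residue O a = α ∧ ∀ g : C[X], g.eval₂ C.subtype a ∈ maximalIdeal O →
      ∃ g' : C[X], g.eval₂ C.subtype a = p * g'.eval₂ C.subtype a := by
  set ρ := (residue O).comp C.subtype with hρ
  have hev : ∀ a : O, residue O a = α → ∀ g : C[X], g.eval₂ C.subtype a ∈ maximalIdeal O →
      g.eval₂ ρ α = 0 := by
    intro a ha g hg
    rw [← ha, hρ, ← hom_eval₂]
    exact (residue_eq_zero_iff _).mpr hg
  have hdiv : ∀ g : C[X], g.map ρ = 0 → ∃ g', g = Polynomial.C (p : C) * g' := by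
    intro g hg
    apply (C_dvd_iff_dvd_coeff _ _).mpr
    intro i
    have h1 : ρ (g.coeff i) = 0 := by rw [← coeff_map, hg, coeff_zero]
    obtain ⟨c', hc', h⟩ := hC.prop.1 _ (g.coeff i).2 ((residue_eq_zero_iff _).mp h1)
    exact ⟨⟨c', hc'⟩, Subtype.ext (by simpa using h)⟩
  have hevp : ∀ (a : O) (g' : C[X]), (Polynomial.C (p : C) * g').eval₂ C.subtype a =
      p * g'.eval₂ C.subtype a := fun a g' => by
    rw [eval₂_mul, eval₂_C, map_natCast]
  by_cases hmon : ∃ f : C[X], f.Monic ∧ f.eval₂ ρ α = 0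
  · classical
    have hex : ∃ n, ∃ f : C[X], f.Monic ∧ f.eval₂ ρ α = 0 ∧ f.natDegree = n := by
      obtain ⟨f, h1, h2⟩ := hmon
      exact ⟨_, f, h1, h2, rfl⟩
    obtain ⟨f, hf, hfα, hfn⟩ := Nat.find_spec hex
    have hmin : ∀ f' : C[X], f'.Monic → f'.eval₂ ρ α = 0 → f.natDegree ≤ f'.natDegree :=
      fun f' h1 h2 => hfn.trans_le (Nat.find_min' hex ⟨f', h1, h2, rfl⟩)
    have hf1 : f ≠ 1 := fun h => one_ne_zero (α := ResidueField O) (by rw [← hfα, h, eval₂_one])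
    obtain ⟨a, ha, hfa⟩ : ∃ a : O, residue O a = α ∧ f.eval₂ C.subtype a = 0 := by
      have h1 := (hsplit (f.map C.subtype) (hf.map _)).eq_prod_roots_of_monic (hf.map _)
      have h2 : f.eval₂ ρ α = ((f.map C.subtype).map (residue O)).eval α := by
        rw [Polynomial.map_map, Polynomial.eval_map]
      rw [hfα, h1, Polynomial.map_multiset_prod, eval_multiset_prod, eq_comm,
        Multiset.prod_eq_zero_iff, Multiset.map_map, Multiset.map_map] at h2
      obtain ⟨a, ha, h3⟩ := Multiset.mem_map.mp h2
      refine ⟨a, ?_, ?_⟩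
      · simp only [Function.comp_apply, Polynomial.map_sub, Polynomial.map_X, Polynomial.map_C,
          eval_sub, eval_X, eval_C] at h3
        exact (sub_eq_zero.mp h3).symm
      · rw [← Polynomial.eval_map]
        exact (mem_roots'.mp ha).2
    refine ⟨a, ha, fun g hg => ?_⟩
    have hmod : ∀ {T : Type} [CommRing T] (τ : C →+* T) (t : T), f.eval₂ τ t = 0 →
        (g %ₘ f).eval₂ τ t = g.eval₂ τ t := by
      intro T _ τ t ht
      conv_rhs => rw [← modByMonic_add_div g f]
      rw [eval₂_add, eval₂_mul, ht, zero_mul, add_zero]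
    have h0 : (g %ₘ f).map ρ = 0 := by
      by_contra h0
      obtain ⟨f', hf', hd, hfα'⟩ := hC.exists_monic α (g %ₘ f) h0 (by
        rw [← hρ, hmod ρ α hfα, hev a ha g hg])
      have := hmin f' hf' hfα'
      have := natDegree_modByMonic_lt g hf hf1
      omega
    obtain ⟨g', hg'⟩ := hdiv _ h0
    exact ⟨g', by rw [← hmod C.subtype a hfa, hg', hevp]⟩
  · obtain ⟨a, ha⟩ := residue_surjective α
    refine ⟨a, ha, fun g hg => ?_⟩
    have h0 : g.map ρ = 0 := by
      by_contra h0
      obtain ⟨f', hf', hd, hfα'⟩ := hC.exists_monic α g h0 (hev a ha g hg)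
      exact hmon ⟨f', hf', hfα'⟩
    obtain ⟨g', hg'⟩ := hdiv _ h0
    exact ⟨g', by rw [← hevp, ← hg']⟩

theorem Maximal.exists_residue_eq [IsDomain O] (hC : Maximal (· ∈ saturatedSubrings ι p) C)
    (hsplit : ∀ f : O[X], f.Monic → f.Splits) (x : k) :
    ∃ c ∈ C, residue O c = ι x := by
  obtain ⟨a, ha, h⟩ := hC.exists_lift hsplit (ι x)
  let E : Subring O := (eval₂RingHom C.subtype a).range
  have hCE : C ≤ E := fun c hc => ⟨Polynomial.C ⟨c, hc⟩, by simp⟩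
  have haE : a ∈ E := ⟨X, by simp⟩
  suffices hE : E ∈ saturatedSubrings ι p from ⟨a, hC.le_of_ge hE hCE haE, ha⟩
  constructor
  · rintro _ ⟨g, rfl⟩ hg
    obtain ⟨g', hg'⟩ := h g hg
    exact ⟨_, ⟨g', rfl⟩, hg'⟩
  · rintro _ ⟨g, rfl⟩
    have hρ : ∀ c : C, residue O c ∈ ι.range := fun c => hC.prop.2 _ c.2
    rw [coe_eval₂RingHom, eval₂_eq_sum, Polynomial.sum, map_sum]
    refine sum_mem fun i _ => ?_
    rw [map_mul, map_pow, ha]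
    exact mul_mem (hρ _) (pow_mem (ι.mem_range_self x) _)

end Saturated

/-- The Hausdorff quotient of a local domain with principal maximal ideal is a principal ideal
domain. -/
theorem isPrincipalIdealRing_quotient_iInf {C : Type} [CommRing C] [IsDomain C] [IsLocalRing C]
    {π : C} (hπ : maximalIdeal C = Ideal.span {π}) (hπ0 : π ≠ 0) :
    ∃ _ : IsDomain (C ⧸ ⨅ n : ℕ, Ideal.span {π ^ n}),
      IsPrincipalIdealRing (C ⧸ ⨅ n : ℕ, Ideal.span {π ^ n}) ∧
      (Ideal.Quotient.mk (⨅ n : ℕ, Ideal.span {π ^ n})) π ≠ 0 := by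
  set J : Ideal C := ⨅ n : ℕ, Ideal.span {π ^ n} with hJ
  have hmem : ∀ x, x ∈ J ↔ ∀ n, π ^ n ∣ x := fun x => by
    simp only [hJ, Ideal.mem_iInf, Ideal.mem_span_singleton]
  have hunit : ∀ x, IsUnit x ↔ ¬ π ∣ x := fun x => by
    rw [← Ideal.mem_span_singleton, ← hπ, mem_maximalIdeal, mem_nonunits_iff, not_not]
  have hfac : ∀ x ∉ J, ∃ n u, IsUnit u ∧ x = π ^ n * u := by
    classical
    intro x hx
    have hex : ∃ n, ¬ π ^ n ∣ x := by
      by_contra h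
      push Not at h
      exact hx ((hmem x).mpr h)
    obtain ⟨m, hm⟩ : ∃ m, Nat.find hex = m + 1 := Nat.exists_eq_succ_of_ne_zero fun h0 =>
      Nat.find_spec hex (by rw [h0, pow_zero]; exact one_dvd x)
    obtain ⟨u, hu⟩ := not_not.mp (Nat.find_min hex (m := m) (by omega))
    refine ⟨m, u, (hunit u).mpr ?_, hu⟩
    rintro ⟨v, rfl⟩
    apply Nat.find_spec hex
    rw [hm, hu]
    exact ⟨v, by ring⟩
  have hnot : ∀ n u, IsUnit u → ¬ π ^ (n + 1) ∣ π ^ n * u := by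
    rintro n u hu ⟨v, hv⟩
    rw [pow_succ, mul_assoc] at hv
    exact (hunit u).mp hu ⟨v, mul_left_cancel₀ (pow_ne_zero n hπ0) hv⟩
  have hprime : J.IsPrime := by
    refine ⟨fun h => ?_, fun {x y} hxy => ?_⟩
    · have h1 : (1 : C) ∈ J := h ▸ Submodule.mem_top
      exact (hunit 1).mp isUnit_one (by simpa using (hmem 1).mp h1 1)
    · by_contra h
      push Not at h
      obtain ⟨n, u, hu, rfl⟩ := hfac x h.1
      obtain ⟨m, v, hv, rfl⟩ := hfac y h.2
      apply hnot (n + m) (u * v) (hu.mul hv)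
      rw [show π ^ (n + m) * (u * v) = π ^ n * u * (π ^ m * v) by ring]
      exact (hmem _).mp hxy _
  have hdom : IsDomain (C ⧸ J) := Ideal.Quotient.isDomain J
  have hπJ : π ∉ J := fun h => hnot 1 1 isUnit_one (by simpa using (hmem π).mp h 2)
  have hπ1 : Ideal.Quotient.mk J π ≠ 0 := fun h => hπJ (Ideal.Quotient.eq_zero_iff_mem.mp h)
  have hfac' : ∀ x : C ⧸ J, x ≠ 0 → ∃ n u, IsUnit u ∧ x = Ideal.Quotient.mk J π ^ n * u := by
    intro x hx
    obtain ⟨y, rfl⟩ := Ideal.Quotient.mk_surjective x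
    obtain ⟨n, u, hu, rfl⟩ := hfac y fun h => hx (Ideal.Quotient.eq_zero_iff_mem.mpr h)
    exact ⟨n, _, hu.map (Ideal.Quotient.mk J), by rw [map_mul, map_pow]⟩
  have hirr : Irreducible (Ideal.Quotient.mk J π) := by
    have hnu : ¬ IsUnit (Ideal.Quotient.mk J π) := fun h => by
      obtain ⟨b, hb⟩ := h.exists_right_inv
      obtain ⟨b, rfl⟩ := Ideal.Quotient.mk_surjective b
      rw [← map_mul, ← map_one (Ideal.Quotient.mk J), Ideal.Quotient.eq] at hb
      have h2 := (hmem _).mp hb 1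
      rw [pow_one] at h2
      exact (hunit 1).mp isUnit_one ((dvd_sub_right (dvd_mul_right π b)).mp h2)
    refine ⟨hnu, fun {a b} hab => ?_⟩
    obtain ⟨n, u, hu, rfl⟩ := hfac' a fun h => hπ1 (by rw [hab, h, zero_mul])
    obtain ⟨m, v, hv, rfl⟩ := hfac' b fun h => hπ1 (by rw [hab, h, mul_zero])
    rcases n with _ | n
    · exact Or.inl (by simpa using hu)
    rcases m with _ | m
    · exact Or.inr (by simpa using hv)
    exfalso
    apply hnu
    refine IsUnit.of_mul_eq_one (Ideal.Quotient.mk J π ^ (n + m) * (u * v)) ?_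
    apply mul_left_cancel₀ hπ1
    conv_rhs => rw [mul_one, hab]
    ring
  have hdvr : IsDiscreteValuationRing (C ⧸ J) :=
    IsDiscreteValuationRing.ofHasUnitMulPowIrreducibleFactorization
      ⟨_, hirr, fun {x} hx => by
        obtain ⟨n, u, hu, h⟩ := hfac' x hx
        obtain ⟨w, rfl⟩ := hu
        exact ⟨n, w, h.symm⟩⟩
  exact ⟨hdom, inferInstance, hπ1⟩

/-- Existence of Cohen rings. -/
theorem exists_cohen_ring (p : ℕ) [Fact p.Prime] (k : Type) [Field k] [CharP k p] :
    ∃ (C : Type) (_ : CommRing C) (_ : IsDomain C) (_ : IsPrincipalIdealRing C) (φ : C →+* k),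
      Function.Surjective φ ∧ RingHom.ker φ = Ideal.span {(p : C)} ∧ (p : C) ≠ 0 := by
  obtain ⟨O, _, _, _, _, ι, hpO, hsplit⟩ := exists_local_domain_splitting p k
  obtain ⟨C, hC⟩ := exists_maximal_saturated ι (Fact.out : p.Prime) hpO
  have hp0 : (p : C) ≠ 0 := fun h => (Fact.out : p.Prime).ne_zero
    (Nat.cast_injective (R := O) (by simpa using congrArg C.subtype h))
  have hunit : ∀ c : C, (c : O) ∉ maximalIdeal O → IsUnit c := fun c hc => by
    obtain ⟨t, ht, h⟩ := Maximal.exists_mul_eq_one hC c.2 hc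
    exact IsUnit.of_mul_eq_one ⟨t, ht⟩ (Subtype.ext h)
  have hlocal : IsLocalHom C.subtype := ⟨fun c hc => hunit c fun h => h hc⟩
  have : IsLocalRing C := C.subtype.domain_isLocalRing
  have hmax : ∀ c : C, (c : O) ∈ maximalIdeal O → ∃ c', c = p * c' := fun c hc => by
    obtain ⟨c', hc', h⟩ := hC.prop.1 c c.2 hc
    exact ⟨⟨c', hc'⟩, Subtype.ext (by simpa using h)⟩
  have hpC : ∀ c : C, ((p * c : C) : O) ∈ maximalIdeal O := fun c => by
    simpa using Ideal.mul_mem_right _ _ hpO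
  have hm : maximalIdeal C = Ideal.span {(p : C)} := by
    ext c
    rw [Ideal.mem_span_singleton]
    constructor
    · exact fun hc => hmax c (by_contra fun h => hc (hunit c h))
    · rintro ⟨c', rfl⟩
      exact fun hu => hpC c' (hu.map C.subtype)
  obtain ⟨hdom, hpid, hp1⟩ := isPrincipalIdealRing_quotient_iInf hm hp0
  let θ : C →+* ι.range := ((residue O).comp C.subtype).codRestrict ι.range
    fun c => hC.prop.2 c c.2
  let e : k ≃+* ι.range := RingEquiv.ofBijective ι.rangeRestrict
    ⟨fun a b h => ι.injective (congrArg Subtype.val h), ι.rangeRestrict_surjective⟩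
  let ψ : C →+* k := e.symm.toRingHom.comp θ
  have hψ : ∀ c, ψ c = 0 ↔ ∃ c', c = p * c' := by
    intro c
    have h1 : ψ c = 0 ↔ residue O c = 0 := by
      change e.symm (θ c) = 0 ↔ _
      rw [EmbeddingLike.map_eq_zero_iff]
      exact Subtype.ext_iff
    rw [h1, residue_eq_zero_iff]
    refine ⟨hmax c, ?_⟩
    rintro ⟨c', rfl⟩
    exact hpC c'
  refine ⟨C ⧸ ⨅ n : ℕ, Ideal.span {(p : C) ^ n}, inferInstance, hdom, hpid,
    Ideal.Quotient.lift _ ψ ?_, ?_, ?_, ?_⟩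
  · intro c hc
    rw [hψ]
    have := Ideal.mem_iInf.mp hc 1
    rwa [pow_one, Ideal.mem_span_singleton] at this
  · apply Ideal.Quotient.lift_surjective_of_surjective
    intro x
    obtain ⟨c, hc, h⟩ := Maximal.exists_residue_eq hC hsplit x
    refine ⟨⟨c, hc⟩, ?_⟩
    change e.symm (θ _) = x
    rw [RingEquiv.symm_apply_eq]
    exact Subtype.ext h
  · ext x
    obtain ⟨c, rfl⟩ := Ideal.Quotient.mk_surjective x
    rw [RingHom.mem_ker, Ideal.Quotient.lift_mk, hψ, Ideal.mem_span_singleton]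
    constructor
    · rintro ⟨c', rfl⟩
      exact ⟨Ideal.Quotient.mk _ c', by simp⟩
    · rintro ⟨y, hy⟩
      obtain ⟨y, rfl⟩ := Ideal.Quotient.mk_surjective y
      rw [← map_natCast (Ideal.Quotient.mk _), ← map_mul, Ideal.Quotient.eq] at hy
      have h2 := Ideal.mem_iInf.mp hy 1
      rw [pow_one, Ideal.mem_span_singleton] at h2
      exact (dvd_sub_left (dvd_mul_right _ y)).mp h2
  · rwa [map_natCast] at hp1

end CohenRing

section Coefficient

theorem factorPow_succ_eq_zero {A : Type} [CommRing A] (I : Ideal A) (n : ℕ) (a : A) :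
    Ideal.Quotient.factorPow I (n + 1).le_succ (Ideal.Quotient.mk (I ^ (n + 2)) a) = 0 ↔
      a ∈ I ^ (n + 1) :=
  Ideal.Quotient.eq_zero_iff_mem

theorem factorPow_succ_mul_eq_zero {A : Type} [CommRing A] (I : Ideal A) (n : ℕ)
    (x y : A ⧸ I ^ (n + 2)) (hx : Ideal.Quotient.factorPow I (n + 1).le_succ x = 0)
    (hy : Ideal.Quotient.factorPow I (n + 1).le_succ y = 0) : x * y = 0 := by
  obtain ⟨a, rfl⟩ := Ideal.Quotient.mk_surjective x
  obtain ⟨b, rfl⟩ := Ideal.Quotient.mk_surjective y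
  rw [factorPow_succ_eq_zero] at hx hy
  rw [← map_mul, Ideal.Quotient.eq_zero_iff_mem]
  have h := Ideal.mul_mem_mul hx hy
  rw [← pow_add] at h
  exact Ideal.pow_le_pow_right (by omega) h

/-- A complete local ring receives a ring homomorphism from a principal ideal domain that
is surjective on residue fields. -/
theorem exists_coefficient_ring (A : Type) [CommRing A] [IsLocalRing A]
    [IsAdicComplete (maximalIdeal A) A] :
    ∃ (C : Type) (_ : CommRing C) (_ : IsDomain C) (_ : IsPrincipalIdealRing C) (φ : C →+* A),
      Function.Surjective ((residue A).comp φ) := by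
  obtain ⟨p, hp⟩ := CharP.exists (ResidueField A)
  have hq : ∀ n, Function.Surjective
      (Ideal.Quotient.factorPow (maximalIdeal A) (n + 1).le_succ) := fun n =>
    Ideal.Quotient.factor_surjective _
  rcases CharP.char_is_prime_or_zero (ResidueField A) p with hpp | rfl
  · have : Fact p.Prime := ⟨hpp⟩
    obtain ⟨C, _, _, _, φ, hφ, hker, hp0⟩ := exists_cohen_ring p (ResidueField A)
    have hpA : (p : A) ∈ maximalIdeal A := by
      rw [← residue_eq_zero_iff, map_natCast, CharP.cast_eq_zero]
    obtain ⟨g, hg⟩ := exists_lift_of_adic (maximalIdeal A) (fun n h =>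
      exists_lift_of_sq_zero (p := p) (fun c hc => (mul_eq_zero.mp hc).resolve_left hp0)
        (hker ▸ RingHom.ker_isMaximal_of_surjective φ hφ) _ (hq n)
        (factorPow_succ_mul_eq_zero _ n) (fun x hx => by
          obtain ⟨a, rfl⟩ := Ideal.Quotient.mk_surjective x
          rw [factorPow_succ_eq_zero] at hx
          rw [← map_natCast (Ideal.Quotient.mk _), ← map_mul, Ideal.Quotient.eq_zero_iff_mem,
            pow_succ']
          exact Ideal.mul_mem_mul hpA hx) h) φ
    exact ⟨C, inferInstance, inferInstance, inferInstance, g, by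
      change Function.Surjective ((Ideal.Quotient.mk (maximalIdeal A)).comp g)
      rwa [hg]⟩
  · have : CharZero (ResidueField A) := CharP.charP_to_charZero _
    have hu : ∀ n : ℤ, n ≠ 0 → IsUnit (n : A) := fun n hn => by
      by_contra h
      have h1 : residue A n = 0 := (residue_eq_zero_iff _).mpr h
      rw [map_intCast, Int.cast_eq_zero] at h1
      exact hn h1
    let r : ℚ →+* A := IsLocalization.lift (M := nonZeroDivisors ℤ) (g := Int.castRingHom A)
      fun y => hu y (nonZeroDivisors.ne_zero y.2)
    let _ : Algebra ℚ A := r.toAlgebra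
    have hsm : Algebra.FormallySmooth ℚ (ResidueField A) := formallySmooth_of_perfectField _ _
    obtain ⟨g, hg⟩ := exists_lift_of_adic (C := ResidueField A) (maximalIdeal A) (fun n h => by
      let q : A ⧸ maximalIdeal A ^ (n + 2) →ₐ[ℚ] A ⧸ maximalIdeal A ^ (n + 1) :=
        (Ideal.Quotient.factorPow (maximalIdeal A) (n + 1).le_succ).toRatAlgHom
      have hnil : IsNilpotent (RingHom.ker q) := by
        refine ⟨2, (pow_two (RingHom.ker q)).trans (eq_bot_iff.mpr (Ideal.mul_le.mpr ?_))⟩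
        intro x hx y hy
        exact factorPow_succ_mul_eq_zero _ n x y hx hy
      refine ⟨(Algebra.FormallySmooth.liftOfSurjective h.toRatAlgHom q (hq n) hnil).toRingHom, ?_⟩
      ext x
      exact Algebra.FormallySmooth.liftOfSurjective_apply h.toRatAlgHom q (hq n) hnil x)
      (RingHom.id (ResidueField A))
    exact ⟨ResidueField A, inferInstance, inferInstance, inferInstance, g, by
      change Function.Surjective ((Ideal.Quotient.mk (maximalIdeal A)).comp g)
      rw [hg]
      exact Function.surjective_id⟩

end Coefficient

section Cohen

theorem isRegularLocalRing_of_isRegularLocal {S : Type} [CommRing S] [IsLocalRing S]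
    [IsNoetherianRing S] (h : IsRegularLocal S) : IsRegularLocalRing S := by
  obtain ⟨s, hs, hd⟩ := h
  apply IsRegularLocalRing.of_spanFinrank_maximalIdeal_le
  rw [← hd, ← hs]
  have := Submodule.spanFinrank_span_le_ncard_of_finite (R := S) s.finite_toSet
  rw [Set.ncard_coe_finset] at this
  exact_mod_cast this

theorem isRegularLocal_of_isRegularLocalRing {S : Type} [CommRing S]
    [h : IsRegularLocalRing S] : IsRegularLocal S := by
  obtain ⟨s, hs, hd⟩ := (IsNoetherian.noetherian
    (maximalIdeal S)).exists_span_finset_card_eq_spanFinrank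
  refine ⟨s, hd, ?_⟩
  rw [← h.spanFinrank_maximalIdeal, hs]
  rfl

/-- The universal property of the adic completion of a ring, for a map onto a complete ring. -/
theorem exists_surjective_adicCompletion_lift {R A : Type} [CommRing R] [CommRing A]
    (I : Ideal R) (hI : I.FG) (f : R →+* A) [IsAdicComplete (I.map f) A]
    (h : Function.Surjective ((Ideal.Quotient.mk (I.map f)).comp f)) :
    ∃ F : AdicCompletion I R →+* A, Function.Surjective F ∧
      F.comp (algebraMap R (AdicCompletion I R)) = f := by
  have hle : ∀ n, I ^ n ≤ ((I.map f) ^ n).comap f := fun n => by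
    rw [← Ideal.map_le_iff_le_comap, Ideal.map_pow]
  let g : ∀ n, AdicCompletion I R →+* A ⧸ (I.map f) ^ n := fun n =>
    (Ideal.quotientMap _ f (hle n)).comp (AdicCompletion.evalₐ I n).toRingHom
  have hg : ∀ {m n : ℕ} (hmn : m ≤ n),
      (Ideal.Quotient.factorPow (I.map f) hmn).comp (g n) = g m := by
    intro m n hmn
    refine RingHom.ext fun x => ?_
    obtain ⟨x, rfl⟩ := AdicCompletion.mk_surjective I R x
    simp only [g, RingHom.comp_apply, AlgHom.toRingHom_eq_coe, RingHom.coe_coe,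
      AdicCompletion.evalₐ_mk, Ideal.quotientMap_mk]
    refine (Ideal.Quotient.eq.mpr ?_)
    rw [← map_sub]
    have h1 := x.2 hmn
    rw [SModEq.sub_mem, smul_eq_mul, Ideal.mul_top] at h1
    exact hle m ((Submodule.sub_mem_iff_left _ (I ^ m).zero_mem).mp
      (by simpa using (I ^ m).neg_mem h1))
  let F := IsAdicComplete.liftRingHom (I.map f) g hg
  have hF : F.comp (algebraMap R (AdicCompletion I R)) = f := by
    refine RingHom.ext fun x => ?_
    rw [← sub_eq_zero]
    refine IsHausdorff.haus (I := I.map f) (M := A) inferInstance _ fun n => ?_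
    rw [SModEq.zero, smul_eq_mul, Ideal.mul_top, ← Ideal.Quotient.eq_zero_iff_mem, map_sub,
      RingHom.comp_apply, IsAdicComplete.mk_liftRingHom, sub_eq_zero]
    simp [g, AdicCompletion.algebraMap_apply]
  refine ⟨F, ?_, hF⟩
  have hmap : (I.map (algebraMap R (AdicCompletion I R))).map F = I.map f := by
    rw [Ideal.map_map, hF]
  have := AdicCompletion.isAdicComplete_self I hI
  have : IsHausdorff ((I.map (algebraMap R (AdicCompletion I R))).map F) A := by
    rw [hmap]; infer_instance
  apply surjective_of_mk_map_comp_surjective (I := I.map (algebraMap R (AdicCompletion I R))) F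
  rw [hmap]
  intro y
  obtain ⟨x, hx⟩ := h y
  exact ⟨algebraMap R _ x, by rw [← hx, ← hF]; rfl⟩


theorem exists_sub_algebraMap_mem (R : Type) [CommRing R] [IsLocalRing R] [IsNoetherianRing R]
    (y : AdicCompletion (maximalIdeal R) R) : ∃ x : R,
      y - algebraMap R _ x ∈ maximalIdeal (AdicCompletion (maximalIdeal R) R) := by
  obtain ⟨x, hx⟩ := Ideal.Quotient.mk_surjective (AdicCompletion.evalOneₐ (maximalIdeal R) y)
  refine ⟨x, ?_⟩
  rw [AdicCompletion.maximalIdeal_eq_map,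
    ← AdicCompletion.ker_evalOneₐ_eq_map _ (IsNoetherian.noetherian _), RingHom.mem_ker, map_sub,
    sub_eq_zero]
  refine hx.symm.trans ?_
  exact (AdicCompletion.evalOneₐ (maximalIdeal R)).commutes x |>.symm

theorem isNoetherianRing_adicCompletion (R : Type) [CommRing R] [IsLocalRing R]
    [IsNoetherianRing R] : IsNoetherianRing (AdicCompletion (maximalIdeal R) R) := by
  obtain ⟨s, hs⟩ := IsNoetherian.noetherian (maximalIdeal R)
  let f : MvPolynomial s R →+* AdicCompletion (maximalIdeal R) R :=
    MvPolynomial.eval₂Hom (algebraMap R _) fun i => algebraMap R _ i.1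
  have hf : (MvPolynomial.idealOfVars s R).map f =
      maximalIdeal (AdicCompletion (maximalIdeal R) R) := by
    have hs' : (maximalIdeal R).map (algebraMap R (AdicCompletion (maximalIdeal R) R)) =
        (Ideal.span (s : Set R)).map (algebraMap R (AdicCompletion (maximalIdeal R) R)) :=
      congrArg _ hs.symm
    rw [AdicCompletion.maximalIdeal_eq_map, hs', MvPolynomial.idealOfVars,
      Ideal.map_span, Ideal.map_span, ← Set.range_comp]
    congr 1
    ext y
    simp [f]
  have : IsAdicComplete ((MvPolynomial.idealOfVars s R).map f)
      (AdicCompletion (maximalIdeal R) R) := by rw [hf]; infer_instance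
  obtain ⟨F, hF, -⟩ := exists_surjective_adicCompletion_lift
    (MvPolynomial.idealOfVars s R) (MvPolynomial.idealOfVars_fg s R) f (by
      rw [hf]
      intro y
      obtain ⟨y, rfl⟩ := Ideal.Quotient.mk_surjective y
      obtain ⟨x, hx⟩ := exists_sub_algebraMap_mem R y
      refine ⟨MvPolynomial.C x, ?_⟩
      rw [RingHom.comp_apply, eq_comm, Ideal.Quotient.eq]
      simpa [f] using hx)
  have : IsNoetherianRing (AdicCompletion (MvPolynomial.idealOfVars s R) (MvPolynomial s R)) :=
    isNoetherianRing_of_ringEquiv _ (MvPowerSeries.toAdicCompletionAlgEquiv s R).toRingEquiv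
  exact isNoetherianRing_of_surjective _ _ F hF

instance isRegularLocalRing_adicCompletion (R : Type) [CommRing R] [IsRegularLocalRing R] :
    IsRegularLocalRing (AdicCompletion (maximalIdeal R) R) := by
  have := isNoetherianRing_adicCompletion R
  apply IsRegularLocalRing.of_spanFinrank_maximalIdeal_le
  rw [AdicCompletion.spanFinrank_maximalIdeal_eq, IsRegularLocalRing.spanFinrank_maximalIdeal,
    ← IsLocalRing.maximalIdeal_height_eq_ringKrullDim,
    ← IsLocalRing.maximalIdeal_height_eq_ringKrullDim]
  have : (maximalIdeal (AdicCompletion (maximalIdeal R) R)).LiesOver (maximalIdeal R) :=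
    ⟨(IsLocalRing.maximalIdeal_comap (algebraMap R (AdicCompletion (maximalIdeal R) R))).symm⟩
  rw [Ideal.height_eq_height_add_of_liesOver_of_hasGoingDown (maximalIdeal R)
    (maximalIdeal (AdicCompletion (maximalIdeal R) R))]
  exact_mod_cast le_self_add

theorem isRegularLocalRing_quotient {S : Type} [CommRing S] [IsRegularLocalRing S] {x : S}
    (hx : x ∈ maximalIdeal S) (hx2 : x ∉ maximalIdeal S * maximalIdeal S) :
    IsRegularLocalRing (S ⧸ Ideal.span {x}) ∧
      ringKrullDim (S ⧸ Ideal.span {x}) + 1 = ringKrullDim S := by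
  have : Nontrivial (S ⧸ Ideal.span {x}) := Ideal.Quotient.nontrivial_iff.mpr fun h =>
    (Ideal.IsPrime.ne_top inferInstance) (top_le_iff.mp (h ▸ (Ideal.span_singleton_le_iff_mem _).mpr hx))
  have hloc : IsLocalRing (S ⧸ Ideal.span {x}) :=
    IsLocalRing.of_surjective' _ Ideal.Quotient.mk_surjective
  obtain ⟨s, hs, hd⟩ := (IsNoetherian.noetherian
    (maximalIdeal S)).exists_span_finset_card_eq_spanFinrank
  have hx' : x ∈ Submodule.span S (s : Set S) := by rw [hd]; exact hx
  obtain ⟨a, -, ha⟩ := Submodule.mem_span_finset.mp hx'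
  have hmem : ∀ i ∈ s, i ∈ maximalIdeal S := fun i hi => hd ▸ Submodule.subset_span hi
  obtain ⟨i, hi, hu⟩ : ∃ i ∈ s, IsUnit (a i) := by
    by_contra! hcon
    refine hx2 (ha ▸ Submodule.sum_mem _ fun i hi => Ideal.mul_mem_mul ?_ (hmem i hi))
    exact (mem_maximalIdeal _).mpr (hcon i hi)
  classical
  have hmax : maximalIdeal (S ⧸ Ideal.span {x}) =
      Ideal.span (((s.erase i).image (Ideal.Quotient.mk (Ideal.span {x})) : Finset _) : Set _) := by
    rw [← ((IsLocalRing.map_maximalIdeal_of_surjective (Ideal.Quotient.mk (Ideal.span {x})) Ideal.Quotient.mk_surjective))]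
    apply le_antisymm
    · rw [← hd]
      change Ideal.map _ (Ideal.span _) ≤ _
      rw [Ideal.map_span, Ideal.span_le]
      have key : ∀ j ∈ s.erase i, Ideal.Quotient.mk (Ideal.span {x}) j ∈ Ideal.span
        (((s.erase i).image (Ideal.Quotient.mk (Ideal.span {x})) : Finset _) : Set (S ⧸ Ideal.span {x})) :=
        fun j hj => Ideal.subset_span (Finset.mem_coe.mpr (Finset.mem_image_of_mem _ hj))
      rintro _ ⟨j, hj, rfl⟩
      by_cases hji : j = i
      · subst hji
        rw [SetLike.mem_coe, ← Ideal.unit_mul_mem_iff_mem _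
          (hu.map (Ideal.Quotient.mk (Ideal.span {x})))]
        have h0 : Ideal.Quotient.mk (Ideal.span {x}) x = 0 :=
          Ideal.Quotient.eq_zero_iff_mem.mpr (Ideal.mem_span_singleton_self x)
        have ha' : a j * j + ∑ l ∈ s.erase j, a l * l = x := by
          rw [← ha]; exact Finset.add_sum_erase _ (fun l => a l * l) hi
        replace h0 := (congrArg _ ha').trans h0
        rw [map_add, map_mul,
          add_eq_zero_iff_eq_neg] at h0
        rw [h0, neg_mem_iff, map_sum]
        refine Submodule.sum_mem _ fun l hl => ?_
        rw [map_mul]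
        exact Ideal.mul_mem_left _ _ (key l hl)
      · exact key j (Finset.mem_erase.mpr ⟨hji, hj⟩)
    · rw [Ideal.span_le]
      intro y hy
      obtain ⟨j, hj, rfl⟩ := Finset.mem_image.mp (Finset.mem_coe.mp hy)
      exact Ideal.mem_map_of_mem _ (hmem j (Finset.mem_of_mem_erase hj))
  have hle : (maximalIdeal (S ⧸ Ideal.span {x})).spanFinrank + 1 ≤ (maximalIdeal S).spanFinrank := by
    rw [hmax, ← hs, ← Finset.card_erase_add_one hi, add_le_add_iff_right]
    refine (Submodule.spanFinrank_span_le_ncard_of_finite (Finset.finite_toSet _)).trans ?_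
    rw [Set.ncard_coe_finset]
    exact Finset.card_image_le
  have hdim : ringKrullDim S ≤ ringKrullDim (S ⧸ Ideal.span {x}) + 1 := by
    rw [← IsLocalRing.maximalIdeal_height_eq_ringKrullDim]
    exact Ideal.height_le_ringKrullDim_quotient_add_one hx
  have h1 := IsRegularLocalRing.spanFinrank_maximalIdeal (R := S)
  have h2 := ringKrullDim_le_spanFinrank_maximalIdeal (S ⧸ Ideal.span {x})
  have h3 : (((maximalIdeal (S ⧸ Ideal.span {x})).spanFinrank + 1 : ℕ) : WithBot ℕ∞) ≤
      ((maximalIdeal S).spanFinrank : ℕ) := by exact_mod_cast hle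
  rw [h1] at h3
  push_cast at h3
  have h4 := h3.trans hdim
  have h5 : ((maximalIdeal (S ⧸ Ideal.span {x})).spanFinrank : WithBot ℕ∞) ≤
      ringKrullDim (S ⧸ Ideal.span {x}) := ENat.WithBot.add_le_add_one_right_iff.mp h4
  refine ⟨IsRegularLocalRing.of_spanFinrank_maximalIdeal_le _ h5, le_antisymm ?_ hdim⟩
  exact le_trans (by gcongr) h3

/-- A ring homomorphism from a regular local ring to a complete local ring, under which the
maximal ideal generates the maximal ideal and which is surjective on residue fields. -/
theorem exists_isRegularLocalRing_hom (A : Type) [CommRing A] [IsLocalRing A]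
    [IsAdicComplete (maximalIdeal A) A] (hA : (maximalIdeal A).FG) :
    ∃ (S : Type) (_ : CommRing S) (_ : IsRegularLocalRing S) (f : S →+* A),
      (maximalIdeal S).map f = maximalIdeal A ∧ Function.Surjective ((residue A).comp f) := by
  obtain ⟨s, hs⟩ := hA
  obtain ⟨C, _, _, _, φ, hφ⟩ := exists_coefficient_ring A
  let g : MvPolynomial s C →+* A := MvPolynomial.eval₂Hom φ fun i => i.1
  let P : Ideal (MvPolynomial s C) := (maximalIdeal A).comap g
  have : IsRegularRing C := inferInstance
  have hreg : IsRegularLocalRing (Localization.AtPrime P) :=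
    IsRegularRing.isRegularLocalRing_localization P
  have hunit : ∀ y : P.primeCompl, IsUnit (g y) := fun y => by
    by_contra hy
    exact y.2 ((mem_maximalIdeal _).mpr hy)
  let f : Localization.AtPrime P →+* A := IsLocalization.lift hunit
  have hf : ∀ x, f (algebraMap _ _ x) = g x := fun x => IsLocalization.lift_eq hunit x
  refine ⟨Localization.AtPrime P, inferInstance, hreg, f, le_antisymm ?_ ?_, fun y => ?_⟩
  · rw [← Localization.AtPrime.map_eq_maximalIdeal, Ideal.map_map, Ideal.map_le_iff_le_comap]
    intro x hx
    rw [Ideal.mem_comap, RingHom.comp_apply, hf]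
    exact hx
  · refine hs.ge.trans (Ideal.span_le.mpr fun x (hx : x ∈ s) => ?_)
    have : f (algebraMap (MvPolynomial s C) _ (MvPolynomial.X ⟨x, hx⟩)) = x := by rw [hf]; simp [g]
    rw [← this]
    refine Ideal.mem_map_of_mem _ ?_
    rw [← Localization.AtPrime.map_eq_maximalIdeal]
    refine Ideal.mem_map_of_mem _ ?_
    rw [Ideal.mem_comap, show g (MvPolynomial.X ⟨x, hx⟩) = x by simp [g]]
    exact hs.le (Ideal.subset_span hx)
  · obtain ⟨c, hc⟩ := hφ y
    refine ⟨algebraMap (MvPolynomial s C) _ (MvPolynomial.C c), ?_⟩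
    rw [RingHom.comp_apply, hf, ← hc]
    simp [g]

theorem exists_isRegularLocalRing_surjective (A : Type) [CommRing A] [IsLocalRing A]
    [IsAdicComplete (maximalIdeal A) A] (hA : (maximalIdeal A).FG) :
    ∃ (S : Type) (_ : CommRing S) (_ : IsRegularLocalRing S) (π : S →+* A),
      Function.Surjective π := by
  obtain ⟨S, _, _, f, hf, hres⟩ := exists_isRegularLocalRing_hom A hA
  have : IsAdicComplete ((maximalIdeal S).map f) A := by rw [hf]; infer_instance
  obtain ⟨F, hF, -⟩ := exists_surjective_adicCompletion_lift (maximalIdeal S)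
    (IsNoetherian.noetherian _) f (by rw [hf]; exact hres)
  exact ⟨_, _, isRegularLocalRing_adicCompletion S, F, hF⟩

/-- Cohen's structure theorem: a complete local ring with finitely generated maximal ideal is a
quotient of a regular local ring by an ideal contained in the square of the maximal ideal. -/
theorem exists_minimal_regular_cover (A : Type) [CommRing A] [IsLocalRing A]
    [IsAdicComplete (maximalIdeal A) A] (hA : (maximalIdeal A).FG) :
    ∃ (S : Type) (_ : CommRing S) (_ : IsRegularLocalRing S) (π : S →+* A),
      Function.Surjective π ∧ RingHom.ker π ≤ maximalIdeal S * maximalIdeal S := by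
  suffices h : ∀ (n : ℕ) (S : Type) [CommRing S] [IsRegularLocalRing S] (π : S →+* A),
      Function.Surjective π → ringKrullDim S = n →
      ∃ (S : Type) (_ : CommRing S) (_ : IsRegularLocalRing S) (π : S →+* A),
        Function.Surjective π ∧ RingHom.ker π ≤ maximalIdeal S * maximalIdeal S by
    obtain ⟨S, _, _, π, hπ⟩ := exists_isRegularLocalRing_surjective A hA
    exact h _ S π hπ IsRegularLocalRing.spanFinrank_maximalIdeal.symm
  intro n
  induction n with
  | zero =>
    intro S _ _ π hπ hd
    by_cases hle : RingHom.ker π ≤ maximalIdeal S * maximalIdeal S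
    · exact ⟨S, inferInstance, inferInstance, π, hπ, hle⟩
    · obtain ⟨x, hx, hx2⟩ := SetLike.not_le_iff_exists.mp hle
      obtain ⟨h1, h2⟩ := isRegularLocalRing_quotient
        (IsLocalRing.le_maximalIdeal (RingHom.ker_ne_top π) hx) hx2
      rw [hd, ← IsRegularLocalRing.spanFinrank_maximalIdeal] at h2
      norm_cast at h2
  | succ n ih =>
    intro S _ _ π hπ hd
    by_cases hle : RingHom.ker π ≤ maximalIdeal S * maximalIdeal S
    · exact ⟨S, inferInstance, inferInstance, π, hπ, hle⟩
    · obtain ⟨x, hx, hx2⟩ := SetLike.not_le_iff_exists.mp hle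
      obtain ⟨h1, h2⟩ := isRegularLocalRing_quotient
        (IsLocalRing.le_maximalIdeal (RingHom.ker_ne_top π) hx) hx2
      refine ih (S ⧸ Ideal.span {x}) (Ideal.Quotient.lift _ π fun y hy => ?_)
        (Ideal.Quotient.lift_surjective_of_surjective _ _ hπ) ?_
      · obtain ⟨z, rfl⟩ := Ideal.mem_span_singleton'.mp hy
        rw [map_mul, RingHom.mem_ker.mp hx, mul_zero]
      · rw [hd, Nat.cast_succ] at h2
        exact ENat.WithBot.add_one_cancel.mp h2

/-- If the completion admits a resolution with bounded Betti numbers, the ring is a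
hypersurface. -/
theorem isHypersurface_of_bounded {R : Type} [CommRing R] [IsLocalRing R] [IsNoetherianRing R]
    (C : MinFreeRes R (ResidueField R)) {B : ℕ} (hB : ∀ i, Module.finrank R (C.F i) ≤ B) :
    IsHypersurface R := by
  let A := AdicCompletion (maximalIdeal R) R
  have hmax : (maximalIdeal R).map (algebraMap R A) = maximalIdeal A :=
    AdicCompletion.maximalIdeal_eq_map.symm
  have hfg : (maximalIdeal A).FG := hmax ▸ Ideal.FG.map (IsNoetherian.noetherian (maximalIdeal R)) _
  have : IsAdicComplete (maximalIdeal A) A := inferInstance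
  obtain ⟨S, _, _, π, hπ, hker⟩ := exists_minimal_regular_cover A hfg
  obtain ⟨b, d, hb, hd, hdd, hex, hex0⟩ := exists_flat_baseChange (A := A) hmax C
  have hb0 : 0 < b 0 := by
    rw [hb, Nat.pos_iff_ne_zero]
    intro h0
    obtain ⟨x, hx⟩ := C.aug_surj 1
    have : IsEmpty (Fin (Module.finrank R (C.F 0))) := by rw [h0]; infer_instance
    have hx0 : x = 0 := (Module.finBasis R (C.F 0)).repr.injective (Subsingleton.elim _ _)
    exact one_ne_zero (hx.symm.trans (by rw [hx0, map_zero]))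
  obtain ⟨f, hf⟩ := (isPrincipal_ker_of_bounded π hπ hker hd hdd hex hex0 hb0
    (fun n => (hb n).trans_le (hB n))).principal
  refine ⟨S, _, inferInstance, inferInstance, isRegularLocal_of_isRegularLocalRing, f, ⟨?_⟩⟩
  exact (RingHom.quotientKerEquivOfSurjective hπ).symm.trans (Ideal.quotEquivOfEq hf)

end Cohen

theorem exists_mem_maximalIdeal_notMem_minimalPrimes {S : Type} [CommRing S] [IsLocalRing S]
    [IsNoetherianRing S] (h0 : ringKrullDim S ≠ 0) :
    ∃ x ∈ maximalIdeal S, x ∉ maximalIdeal S * maximalIdeal S ∧ ∀ P ∈ minimalPrimes S, x ∉ P := by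
  classical
  have hht : (maximalIdeal S).height ≠ 0 := by
    rw [← IsLocalRing.maximalIdeal_height_eq_ringKrullDim] at h0
    exact fun h => h0 (by rw [h]; rfl)
  have hfin := Ideal.finite_minimalPrimes_of_isNoetherianRing S ⊥
  let I := maximalIdeal S * maximalIdeal S
  let s : Finset (Ideal S) := insert I hfin.toFinset
  have hns : ¬ ((maximalIdeal S : Set S) ⊆ ⋃ i ∈ (↑s : Set (Ideal S)), (id i : Ideal S)) := by
    rw [Ideal.subset_union_prime I I]
    · rintro ⟨J, hJ, hle⟩
      rcases Finset.mem_insert.mp hJ with rfl | hJ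
      · have hb : maximalIdeal S = ⊥ := Submodule.eq_bot_of_le_smul_of_le_jacobson_bot
          (maximalIdeal S) (maximalIdeal S) (IsNoetherian.noetherian _) hle
          (IsLocalRing.maximalIdeal_le_jacobson _)
        exact hht (by rw [hb, Ideal.height_bot])
      · have hJ' : J ∈ minimalPrimes S := hfin.mem_toFinset.mp hJ
        have := hJ'.1.1
        have hJm : J = maximalIdeal S := le_antisymm (IsLocalRing.le_maximalIdeal this.ne_top) hle
        rw [hJm] at hJ'
        rw [ne_eq, Ideal.height_eq_zero_iff] at hht
        exact hht hJ'
    · intro i hi h1 _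
      rcases Finset.mem_insert.mp hi with rfl | hJ
      · exact absurd rfl h1
      · exact (hfin.mem_toFinset.mp hJ).1.1
  rw [Set.not_subset] at hns
  obtain ⟨x, hx, hxs⟩ := hns
  simp only [Set.mem_iUnion, not_exists] at hxs
  exact ⟨x, hx, hxs I (Finset.mem_coe.mpr (Finset.mem_insert_self _ _)), fun P hP =>
    hxs P (Finset.mem_coe.mpr (Finset.mem_insert_of_mem (hfin.mem_toFinset.mpr hP)))⟩

theorem IsRegularLocalRing.isDomain_and_exists_isWeaklyRegular (n : ℕ) : ∀ (S : Type) [CommRing S]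
    [IsRegularLocalRing S], ringKrullDim S = n → IsDomain S ∧ ∃ rs : List S,
      RingTheory.Sequence.IsWeaklyRegular S rs ∧ Ideal.ofList rs = maximalIdeal S := by
  induction n with
  | zero =>
    intro S _ _ hS
    have h := IsRegularLocalRing.spanFinrank_maximalIdeal (R := S)
    rw [hS] at h
    have h' : (maximalIdeal S).spanFinrank = 0 := by exact_mod_cast h
    have hb : maximalIdeal S = ⊥ :=
      (Submodule.spanFinrank_eq_zero_iff_eq_bot (IsNoetherian.noetherian _)).mp h'
    exact ⟨(IsLocalRing.isField_iff_maximalIdeal_eq.mpr hb).isDomain, [],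
      RingTheory.Sequence.IsWeaklyRegular.nil S S, by rw [hb, Ideal.ofList_nil]⟩
  | succ n ih =>
    intro S _ _ hS
    obtain ⟨x, hx, hx2, hxP⟩ := exists_mem_maximalIdeal_notMem_minimalPrimes (S := S)
      (by rw [hS]; exact_mod_cast n.succ_ne_zero)
    obtain ⟨hreg, hdim⟩ := isRegularLocalRing_quotient hx hx2
    obtain ⟨hdom, rs, hrs, hspan⟩ := ih (S ⧸ Ideal.span {x}) (by
      rw [hS] at hdim
      push_cast at hdim
      exact ENat.WithBot.add_one_cancel.mp hdim)
    have hprime : (Ideal.span {x}).IsPrime := (Ideal.Quotient.isDomain_iff_prime _).mp hdom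
    obtain ⟨P, hP, hPx⟩ := Ideal.exists_minimalPrimes_le (I := ⊥) (J := Ideal.span {x}) bot_le
    have hPbot : P = ⊥ := by
      have := hP.1.1
      refine Submodule.eq_bot_of_le_smul_of_le_jacobson_bot (Ideal.span {x}) P
        (IsNoetherian.noetherian _) (fun y hy => ?_)
        (((Ideal.span_singleton_le_iff_mem _).mpr hx).trans
          (IsLocalRing.maximalIdeal_le_jacobson _))
      obtain ⟨z, rfl⟩ := Ideal.mem_span_singleton'.mp (hPx hy)
      rw [mul_comm]
      exact Submodule.smul_mem_smul (Ideal.mem_span_singleton_self x)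
        ((this.mem_or_mem hy).resolve_right (hxP P hP))
    have hbp := hP.1.1
    rw [hPbot] at hbp
    have hdomS : IsDomain S := IsDomain.of_bot_isPrime S
    obtain ⟨rs', rfl⟩ : ∃ rs' : List S, rs'.map (Ideal.Quotient.mk (Ideal.span {x})) = rs :=
      List.map_surjective_iff.mpr Ideal.Quotient.mk_surjective rs
    refine ⟨hdomS, x :: rs', RingTheory.Sequence.IsWeaklyRegular.cons ?_ ?_, ?_⟩
    · have : x ≠ 0 := fun h => hx2 (h ▸ Ideal.zero_mem _)
      exact (IsRegular.of_ne_zero this).left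
    · have e : QuotSMulTop x S ≃ₗ[S] S ⧸ Ideal.span {x} :=
        Submodule.quotEquivOfEq _ _ (by
          rw [← Submodule.ideal_span_singleton_smul, smul_eq_mul, Ideal.mul_top])
      rw [e.isWeaklyRegular_congr]
      exact (RingTheory.Sequence.isWeaklyRegular_map_algebraMap_iff
        (S ⧸ Ideal.span {x}) (S ⧸ Ideal.span {x}) rs').mp hrs
    · rw [← Ideal.map_ofList, ← IsLocalRing.map_maximalIdeal_of_surjective
        (Ideal.Quotient.mk (Ideal.span {x})) Ideal.Quotient.mk_surjective] at hspan
      have := congrArg (Ideal.comap (Ideal.Quotient.mk (Ideal.span {x}))) hspan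
      rw [Ideal.comap_map_of_surjective _ Ideal.Quotient.mk_surjective,
        Ideal.comap_map_of_surjective _ Ideal.Quotient.mk_surjective, ← RingHom.ker_eq_comap_bot,
        Ideal.mk_ker, sup_eq_left.mpr ((Ideal.span_singleton_le_iff_mem _).mpr hx)] at this
      rw [Ideal.ofList_cons, sup_comm, this]

theorem IsRegularLocalRing.exists_ringKrullDim_eq (S : Type) [CommRing S] [IsRegularLocalRing S] :
    ∃ n : ℕ, ringKrullDim S = n :=
  ⟨_, (IsRegularLocalRing.spanFinrank_maximalIdeal (R := S)).symm⟩

theorem IsRegularLocalRing.isDomain (S : Type) [CommRing S] [IsRegularLocalRing S] : IsDomain S :=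
  have ⟨n, hn⟩ := IsRegularLocalRing.exists_ringKrullDim_eq S
  (IsRegularLocalRing.isDomain_and_exists_isWeaklyRegular n S hn).1

theorem IsRegularLocalRing.exists_hasProjectiveDimensionLT (S : Type) [CommRing S]
    [IsRegularLocalRing S] :
    ∃ d : ℕ, HasProjectiveDimensionLT (ModuleCat.of S (S ⧸ maximalIdeal S)) d := by
  obtain ⟨n, hn⟩ := IsRegularLocalRing.exists_ringKrullDim_eq S
  obtain ⟨-, rs, hrs, hspan⟩ := IsRegularLocalRing.isDomain_and_exists_isWeaklyRegular n S hn
  have hpd := ModuleCat.projectiveDimension_quotient_eq_add_length_of_isWeaklyRegular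
    (ModuleCat.of S S) rs hrs (fun r hr => hspan ▸ Ideal.subset_span hr)
  have hS : projectiveDimension (ModuleCat.of S S) ≤ (0 : ℕ) := by
    rw [projectiveDimension_le_iff, ← projective_iff_hasProjectiveDimensionLE_zero]
    exact (IsProjective.iff_projective S).mp inferInstance
  have e : (S ⧸ Ideal.ofList rs • (⊤ : Submodule S S)) ≃ₗ[S] S ⧸ maximalIdeal S :=
    Submodule.quotEquivOfEq _ _ (by rw [smul_eq_mul, Ideal.mul_top, hspan])
  refine ⟨rs.length + 1, ?_⟩
  rw [← HasProjectiveDimensionLE, ← projectiveDimension_le_iff,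
    ← projectiveDimension_eq_of_iso e.toModuleIso]
  refine hpd.le.trans ?_
  calc _ ≤ ((0 : ℕ) : WithBot ℕ∞) + rs.length := by gcongr
    _ = _ := by simp

section ProjectiveDimension

variable {S : Type} [CommRing S] {M N : Type} [AddCommGroup M] [Module S M] [AddCommGroup N]
  [Module S N]

theorem CategoryTheory.HasProjectiveDimensionLT.of_linearEquiv {n : ℕ}
    (h : HasProjectiveDimensionLT (ModuleCat.of S M) n) (e : M ≃ₗ[S] N) :
    HasProjectiveDimensionLT (ModuleCat.of S N) n :=
  hasProjectiveDimensionLT_of_iso e.toModuleIso n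

theorem CategoryTheory.HasProjectiveDimensionLT.ker {n : ℕ} {g : M →ₗ[S] N} (hg : Function.Surjective g)
    (hM : HasProjectiveDimensionLT (ModuleCat.of S M) n)
    (hN : HasProjectiveDimensionLT (ModuleCat.of S N) (n + 1)) :
    HasProjectiveDimensionLT (ModuleCat.of S (LinearMap.ker g)) n :=
  (LinearMap.shortExact_shortComplexKer hg).hasProjectiveDimensionLT_X₁ n hM hN

theorem CategoryTheory.HasProjectiveDimensionLT.of_ker {n : ℕ} {g : M →ₗ[S] N} (hg : Function.Surjective g)
    (hk : HasProjectiveDimensionLT (ModuleCat.of S (LinearMap.ker g)) n)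
    (hM : HasProjectiveDimensionLT (ModuleCat.of S M) (n + 1)) :
    HasProjectiveDimensionLT (ModuleCat.of S N) (n + 1) :=
  (LinearMap.shortExact_shortComplexKer hg).hasProjectiveDimensionLT_X₃ n hk hM

theorem hasProjectiveDimensionLT_one_iff :
    HasProjectiveDimensionLT (ModuleCat.of S M) 1 ↔ Module.Projective S M := by
  rw [IsProjective.iff_projective, projective_iff_hasProjectiveDimensionLT_one]

theorem hasProjectiveDimensionLT_succ_of_projective [Module.Projective S M] (n : ℕ) :
    HasProjectiveDimensionLT (ModuleCat.of S M) (n + 1) :=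
  have := (hasProjectiveDimensionLT_one_iff (S := S) (M := M)).mpr inferInstance
  hasProjectiveDimensionLT_of_ge _ 1 (n + 1) (by lia)

end ProjectiveDimension

section HypersurfaceSyzygies

variable {S A : Type} [CommRing S] [CommRing A] [Algebra S A] {f : S}

variable (S A) in
/-- The coordinatewise reduction of vectors. -/
def reduceVec (b : ℕ) : (Fin b → S) →ₗ[S] (Fin b → A) :=
  (Algebra.linearMap S A).compLeft (Fin b)

@[simp]
theorem reduceVec_apply (b : ℕ) (v : Fin b → S) (i : Fin b) :
    reduceVec S A b v i = algebraMap S A (v i) := rfl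

theorem reduceVec_surjective (hA : Function.Surjective (algebraMap S A)) (b : ℕ) :
    Function.Surjective (reduceVec S A b) := fun w =>
  ⟨fun i => (hA (w i)).choose, funext fun i => (hA (w i)).choose_spec⟩

theorem reduceVec_eq_zero_iff (hker : RingHom.ker (algebraMap S A) = Ideal.span {f}) {b : ℕ}
    {v : Fin b → S} : reduceVec S A b v = 0 ↔ ∃ w, v = f • w := by
  constructor
  · intro h
    have h' : ∀ i, ∃ c, v i = f * c := fun i => by
      have : v i ∈ RingHom.ker (algebraMap S A) := congrFun h i
      rw [hker] at this
      exact Ideal.mem_span_singleton.mp this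
    choose w hw using h'
    exact ⟨w, funext hw⟩
  · rintro ⟨w, rfl⟩
    have : f ∈ RingHom.ker (algebraMap S A) := hker ▸ Ideal.mem_span_singleton_self f
    funext i
    simp [(RingHom.mem_ker).mp this]

variable {N N' : Type} [AddCommGroup N] [Module A N] [Module S N] [IsScalarTower S A N]
  [AddCommGroup N'] [Module A N'] [Module S N'] [IsScalarTower S A N'] {b b' : ℕ}

variable (S) in
/-- A cover of an `A`-module by a free `S`-module. -/
def liftedCover (p : (Fin b → A) →ₗ[A] N) : (Fin b → S) →ₗ[S] N :=
  p.restrictScalars S ∘ₗ reduceVec S A b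

@[simp]
theorem liftedCover_apply (p : (Fin b → A) →ₗ[A] N) (v : Fin b → S) :
    liftedCover S p v = p (reduceVec S A b v) := rfl

theorem liftedCover_surjective (hA : Function.Surjective (algebraMap S A))
    {p : (Fin b → A) →ₗ[A] N} (hp : Function.Surjective p) :
    Function.Surjective (liftedCover S p) :=
  hp.comp (reduceVec_surjective hA b)

theorem ker_liftedCover_le [IsLocalRing S] [IsLocalRing A]
    {p : (Fin b → A) →ₗ[A] N}
    (hk : LinearMap.ker p ≤ maximalIdeal A • (⊤ : Submodule A (Fin b → A))) :
    LinearMap.ker (liftedCover S p) ≤ maximalIdeal S • (⊤ : Submodule S (Fin b → S)) := by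
  intro v hv
  rw [mem_smul_top_pi_iff]
  intro i
  have h := (mem_smul_top_pi_iff _ _).mp (hk (show reduceVec S A b v ∈ LinearMap.ker p from hv)) i
  rw [reduceVec_apply, mem_maximalIdeal] at h
  exact (mem_maximalIdeal _).mpr fun hu => h (hu.map _)

theorem smul_mem_ker_liftedCover (hker : RingHom.ker (algebraMap S A) = Ideal.span {f})
    (p : (Fin b → A) →ₗ[A] N) (v : Fin b → S) : f • v ∈ LinearMap.ker (liftedCover S p) := by
  rw [LinearMap.mem_ker, liftedCover_apply, (reduceVec_eq_zero_iff hker).mpr ⟨v, rfl⟩, map_zero]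

variable (S) in
/-- The map from the kernel of the lifted cover onto the kernel of the cover. -/
def kerReduce (p : (Fin b → A) →ₗ[A] N) (e : LinearMap.ker p ≃ₗ[A] N') :
    LinearMap.ker (liftedCover S p) →ₗ[S] N' where
  toFun v := e ⟨reduceVec S A b v, v.2⟩
  map_add' v w := by rw [← map_add]; congr 1; ext i; simp
  map_smul' c v := by
    rw [RingHom.id_apply, ← algebraMap_smul A c (e _), ← map_smul]
    congr 1; ext i; simp [Algebra.smul_def]

theorem kerReduce_apply (p : (Fin b → A) →ₗ[A] N) (e : LinearMap.ker p ≃ₗ[A] N')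
    (v : LinearMap.ker (liftedCover S p)) : kerReduce S p e v = e ⟨reduceVec S A b v, v.2⟩ := rfl

theorem kerReduce_eq_zero_iff (p : (Fin b → A) →ₗ[A] N) (e : LinearMap.ker p ≃ₗ[A] N')
    (v : LinearMap.ker (liftedCover S p)) :
    kerReduce S p e v = 0 ↔ reduceVec S A b v = 0 := by
  rw [kerReduce_apply, LinearEquiv.map_eq_zero_iff, Subtype.ext_iff, Submodule.coe_zero]

theorem kerReduce_surjective (hA : Function.Surjective (algebraMap S A))
    (p : (Fin b → A) →ₗ[A] N) (e : LinearMap.ker p ≃ₗ[A] N') :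
    Function.Surjective (kerReduce S p e) := by
  intro y
  obtain ⟨v, hv⟩ := reduceVec_surjective hA b (e.symm y).1
  refine ⟨⟨v, ?_⟩, ?_⟩
  · rw [LinearMap.mem_ker, liftedCover_apply, hv]
    exact (e.symm y).2
  · rw [kerReduce_apply, ← e.eq_symm_apply]
    exact Subtype.ext hv

/-- Over a hypersurface, the numbers of generators of successive syzygies of projective dimension
at most one over the ambient ring do not increase, and if the number of generators stays the same
then the syzygies repeat with period two. -/
theorem le_and_nonempty_equiv_of_projective [IsLocalRing S] [IsNoetherianRing S] [IsDomain S]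
    [IsLocalRing A]
    (hA : Function.Surjective (algebraMap S A))
    (hker : RingHom.ker (algebraMap S A) = Ideal.span {f}) (hf : f ≠ 0)
    {p : (Fin b → A) →ₗ[A] N} (hp : Function.Surjective p) (e : LinearMap.ker p ≃ₗ[A] N')
    {p' : (Fin b' → A) →ₗ[A] N'} (hp' : Function.Surjective p')
    (hk' : LinearMap.ker p' ≤ maximalIdeal A • (⊤ : Submodule A (Fin b' → A)))
    (hproj : Module.Projective S (LinearMap.ker (liftedCover S p))) :
    b' ≤ b ∧ (b' = b → Nonempty (N ≃ₗ[A] LinearMap.ker p')) := by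
  set L := LinearMap.ker (liftedCover S p) with hL
  have hfree : Module.Free S L := Module.free_of_flat_of_isLocalRing
  let μ : (Fin b → S) →ₗ[S] L :=
    ((LinearMap.lsmul S (Fin b → S)) f).codRestrict L (smul_mem_ker_liftedCover hker p)
  have hμ : ∀ v, (μ v : Fin b → S) = f • v := fun v => rfl
  have hrank : Module.finrank S L = b := by
    apply le_antisymm
    · exact (LinearMap.finrank_le_finrank_of_injective L.injective_subtype).trans (by simp)
    · have : Function.Injective μ := fun v w h => by
        have := congrArg Subtype.val h
        rw [hμ, hμ] at this
        exact smul_right_injective _ hf this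
      simpa using LinearMap.finrank_le_finrank_of_injective this
  obtain ⟨φ, hφ⟩ := exists_lift_of_projective (liftedCover S p') (kerReduce S p e)
    (fun x => liftedCover_surjective hA hp' _)
  have hφs : Function.Surjective φ := surjective_of_minimal_cover (kerReduce S p e)
    (kerReduce_surjective hA p e) (liftedCover S p') (ker_liftedCover_le hk')
    (LinearEquiv.refl S N') φ (LinearMap.ext hφ)
  refine ⟨?_, fun hb => ?_⟩
  · have := LinearMap.finrank_le_finrank_of_surjective hφs
    rwa [hrank, Module.finrank_fin_fun] at this
  · subst hb
    have hφi : Function.Injective φ := by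
      let θ : (Fin b' → S) ≃ₗ[S] L := LinearEquiv.ofFinrankEq _ _ (by rw [hrank]; simp)
      have := OrzechProperty.injective_of_surjective_endomorphism (φ ∘ₗ θ.toLinearMap)
        (hφs.comp θ.surjective)
      intro x y hxy
      apply θ.symm.injective
      apply this
      simpa using hxy
    have hmem : ∀ v, reduceVec S A b' (φ (μ v)) ∈ LinearMap.ker p' := fun v => by
      have h := hφ (μ v)
      rwa [(kerReduce_eq_zero_iff p e _).mpr ((reduceVec_eq_zero_iff hker).mpr ⟨v, hμ v⟩)] at h
    let ψ : (Fin b' → S) →ₗ[S] (LinearMap.ker p').restrictScalars S :=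
      (reduceVec S A b' ∘ₗ φ ∘ₗ μ).codRestrict _ hmem
    have hψs : Function.Surjective ψ := by
      rintro ⟨y, hy⟩
      obtain ⟨w, rfl⟩ := reduceVec_surjective hA b' y
      obtain ⟨l, rfl⟩ := hφs w
      have hl : kerReduce S p e l = 0 := (hφ l).symm.trans hy
      obtain ⟨v, hv⟩ := (reduceVec_eq_zero_iff hker).mp ((kerReduce_eq_zero_iff p e l).mp hl)
      have : l = μ v := Subtype.ext hv
      subst this
      exact ⟨v, rfl⟩
    have hψk : LinearMap.ker ψ = LinearMap.ker (liftedCover S p) := by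
      ext v
      have h1 : v ∈ LinearMap.ker ψ ↔ reduceVec S A b' (φ (μ v)) = 0 := by
        rw [LinearMap.mem_ker, Subtype.ext_iff]; rfl
      rw [h1, reduceVec_eq_zero_iff hker]
      constructor
      · rintro ⟨w, hw⟩
        obtain ⟨l, rfl⟩ := hφs w
        rw [← map_smul] at hw
        have := congrArg Subtype.val (hφi hw)
        rw [hμ, Submodule.coe_smul] at this
        rw [smul_right_injective _ hf this]
        exact l.2
      · intro hv
        refine ⟨φ ⟨v, hv⟩, ?_⟩
        rw [← map_smul]
        rfl
    let E : N ≃ₗ[S] LinearMap.ker p' :=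
      ((liftedCover S p).quotKerEquivOfSurjective (liftedCover_surjective hA hp)).symm ≪≫ₗ
        (Submodule.quotEquivOfEq _ _ hψk.symm) ≪≫ₗ ψ.quotKerEquivOfSurjective hψs
    exact ⟨LinearEquiv.extendScalarsOfSurjective hA E⟩

end HypersurfaceSyzygies

theorem subsingleton_ker_of_projective {S M : Type} [CommRing S] [IsLocalRing S]
    [AddCommGroup M] [Module S M] [Module.Projective S M] {b : ℕ} {p : (Fin b → S) →ₗ[S] M}
    (hp : Function.Surjective p)
    (hk : LinearMap.ker p ≤ maximalIdeal S • (⊤ : Submodule S (Fin b → S))) :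
    Subsingleton (LinearMap.ker p) := by
  obtain ⟨s, hs⟩ := Module.projective_lifting_property p LinearMap.id hp
  have hps : ∀ y, p (s y) = y := fun y => LinearMap.congr_fun hs y
  have hsurj : Function.Surjective s := by
    rw [← LinearMap.range_eq_top]
    refine top_le_iff.mp (Submodule.le_of_le_smul_of_le_jacobson_bot Module.Finite.fg_top
      (IsLocalRing.maximalIdeal_le_jacobson ⊥) fun x _ => ?_)
    rw [show x = s (p x) + (x - s (p x)) by abel]
    exact Submodule.add_mem_sup ⟨_, rfl⟩ (hk (by simp [hps]))
  rw [Submodule.subsingleton_iff_eq_bot, Submodule.eq_bot_iff]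
  intro x hx
  obtain ⟨y, rfl⟩ := hsurj x
  rw [LinearMap.mem_ker, hps] at hx
  rw [hx, map_zero]

theorem subsingleton_of_minimal_cover {A M : Type} [CommRing A] [IsLocalRing A]
    [AddCommGroup M] [Module A M] [Subsingleton M] {b : ℕ} {p : (Fin b → A) →ₗ[A] M}
    (hk : LinearMap.ker p ≤ maximalIdeal A • (⊤ : Submodule A (Fin b → A))) :
    Subsingleton (Fin b → A) := by
  have hbot : (⊤ : Submodule A (Fin b → A)) = ⊥ :=
    Submodule.eq_bot_of_le_smul_of_le_jacobson_bot (maximalIdeal A) _ Module.Finite.fg_top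
      (fun x _ => hk (LinearMap.mem_ker.mpr (Subsingleton.elim _ _)))
      (IsLocalRing.maximalIdeal_le_jacobson _)
  exact (Submodule.subsingleton_iff A).mp (subsingleton_of_bot_eq_top hbot.symm)

section HypersurfaceSyzygies

variable {S A : Type} [CommRing S] [CommRing A] [Algebra S A] {f : S}

theorem hasProjectiveDimensionLT_two_pi [IsDomain S]
    (hA : Function.Surjective (algebraMap S A))
    (hker : RingHom.ker (algebraMap S A) = Ideal.span {f}) (b : ℕ) :
    HasProjectiveDimensionLT (ModuleCat.of S (Fin b → A)) 2 := by
  refine HasProjectiveDimensionLT.of_ker (n := 1) (reduceVec_surjective hA b) ?_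
    (hasProjectiveDimensionLT_succ_of_projective 1)
  rw [hasProjectiveDimensionLT_one_iff]
  by_cases hf : f = 0
  · have : Subsingleton (LinearMap.ker (reduceVec S A b)) := by
      rw [Submodule.subsingleton_iff_eq_bot, Submodule.eq_bot_iff]
      intro v hv
      obtain ⟨w, rfl⟩ := (reduceVec_eq_zero_iff hker).mp hv
      rw [hf, zero_smul]
    infer_instance
  · let μ : (Fin b → S) →ₗ[S] LinearMap.ker (reduceVec S A b) :=
      ((LinearMap.lsmul S (Fin b → S)) f).codRestrict _
        fun v => (reduceVec_eq_zero_iff hker).mpr ⟨v, rfl⟩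
    refine Module.Projective.of_equiv (LinearEquiv.ofBijective μ ⟨fun v w h => ?_, ?_⟩)
    · exact smul_right_injective _ hf (congrArg Subtype.val h)
    · rintro ⟨v, hv⟩
      obtain ⟨w, rfl⟩ := (reduceVec_eq_zero_iff hker).mp hv
      exact ⟨w, rfl⟩

theorem exists_hasProjectiveDimensionLT_of_equiv_residueField [IsRegularLocalRing S]
    [IsLocalRing A] (hA : Function.Surjective (algebraMap S A)) {N : Type} [AddCommGroup N]
    [Module A N] [Module S N] [IsScalarTower S A N] (e : N ≃ₗ[A] A ⧸ maximalIdeal A) :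
    ∃ d, HasProjectiveDimensionLT (ModuleCat.of S N) d := by
  obtain ⟨d, hd⟩ := IsRegularLocalRing.exists_hasProjectiveDimensionLT S
  refine ⟨d, hd.of_linearEquiv ?_⟩
  let g : S →ₗ[S] N := LinearMap.toSpanSingleton S N (e.symm 1)
  have hg : ∀ s, g s = e.symm (Ideal.Quotient.mk _ (algebraMap S A s)) := fun s => by
    change s • e.symm 1 = _
    rw [← algebraMap_smul A s (e.symm 1), ← map_smul]
    congr 1
    rw [Algebra.smul_def, mul_one]
    rfl
  have hgs : Function.Surjective g := fun x => by
    obtain ⟨a, ha⟩ := Ideal.Quotient.mk_surjective (e x)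
    obtain ⟨s, rfl⟩ := hA a
    exact ⟨s, by rw [hg, ha, e.symm_apply_apply]⟩
  have hgk : maximalIdeal S = LinearMap.ker g := by
    have : IsLocalHom (algebraMap S A) := .of_surjective _ hA
    ext s
    rw [LinearMap.mem_ker, hg, LinearEquiv.map_eq_zero_iff, Ideal.Quotient.eq_zero_iff_mem,
      mem_maximalIdeal, mem_maximalIdeal, mem_nonunits_iff, mem_nonunits_iff, isUnit_map_iff]
  exact Submodule.quotEquivOfEq _ _ hgk ≪≫ₗ g.quotKerEquivOfSurjective hgs

/-- Over a hypersurface, a minimal free resolution of the residue field is eventually periodic of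
period two. -/
theorem exists_nonempty_equiv_add_two [IsRegularLocalRing S] [IsLocalRing A]
    (hA : Function.Surjective (algebraMap S A))
    (hker : RingHom.ker (algebraMap S A) = Ideal.span {f})
    (N : ℕ → Type) [∀ n, AddCommGroup (N n)] [∀ n, Module A (N n)] (b : ℕ → ℕ)
    (p : ∀ n, (Fin (b n) → A) →ₗ[A] N n) (hp : ∀ n, Function.Surjective (p n))
    (hk : ∀ n, LinearMap.ker (p n) ≤ maximalIdeal A • (⊤ : Submodule A (Fin (b n) → A)))
    (e : ∀ n, LinearMap.ker (p n) ≃ₗ[A] N (n + 1)) (e₀ : N 0 ≃ₗ[A] A ⧸ maximalIdeal A) :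
    ∃ n, Nonempty (N n ≃ₗ[A] N (n + 2)) := by
  have := IsRegularLocalRing.isDomain S
  let : ∀ n, Module S (N n) := fun n => Module.compHom _ (algebraMap S A)
  have : ∀ n, IsScalarTower S A (N n) := fun n => IsScalarTower.of_algebraMap_smul fun _ _ => rfl
  have hstep : ∀ k n, HasProjectiveDimensionLT (ModuleCat.of S (N n)) (k + 3) →
      HasProjectiveDimensionLT (ModuleCat.of S (N (n + 1))) (k + 2) := fun k n h => by
    have h2 := hasProjectiveDimensionLT_two_pi hA hker (b n)
    have h2' := hasProjectiveDimensionLT_of_ge (ModuleCat.of S (Fin (b n) → A)) 2 (k + 2) (by lia)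
    exact (HasProjectiveDimensionLT.ker (g := (p n).restrictScalars S) (hp n) h2' h).of_linearEquiv
      ((e n).restrictScalars S)
  have hiter : ∀ k n, HasProjectiveDimensionLT (ModuleCat.of S (N n)) (k + 2) →
      HasProjectiveDimensionLT (ModuleCat.of S (N (n + k))) 2 := by
    intro k
    induction k with
    | zero => exact fun n h => h
    | succ k ih =>
      intro n h
      rw [show n + (k + 1) = (n + 1) + k by ring]
      exact ih _ (hstep k n h)
  obtain ⟨d, hd⟩ := exists_hasProjectiveDimensionLT_of_equiv_residueField hA e₀
  have hbase : HasProjectiveDimensionLT (ModuleCat.of S (N d)) 2 := by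
    have := hasProjectiveDimensionLT_of_ge (ModuleCat.of S (N 0)) d (d + 2) (by lia)
    have h := hiter d 0 this
    generalize hm : 0 + d = m at h
    rw [zero_add] at hm
    subst hm
    exact h
  have hall : ∀ n, HasProjectiveDimensionLT (ModuleCat.of S (N (d + n))) 2 := by
    intro n
    induction n with
    | zero => exact hbase
    | succ n ih =>
      exact hstep 0 _ (hasProjectiveDimensionLT_of_ge _ 2 3 (by lia))
  have hproj : ∀ n, Module.Projective S (LinearMap.ker (liftedCover S (p (d + n)))) := fun n => by
    rw [← hasProjectiveDimensionLT_one_iff]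
    exact HasProjectiveDimensionLT.ker (liftedCover_surjective hA (hp _))
      (hasProjectiveDimensionLT_succ_of_projective 0) (hall n)
  by_cases hf : f = 0
  · have h1 : Module.Projective S (N (d + 1)) := by
      have := hproj 0
      refine Module.Projective.of_equiv (LinearEquiv.ofBijective (kerReduce S (p d) (e d))
        ⟨?_, kerReduce_surjective hA (p d) (e d)⟩)
      rw [injective_iff_map_eq_zero]
      intro v hv
      obtain ⟨w, hw⟩ := (reduceVec_eq_zero_iff hker).mp ((kerReduce_eq_zero_iff _ _ v).mp hv)
      exact Subtype.ext (by rw [hw, hf, zero_smul, Submodule.coe_zero])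
    have h2 : Subsingleton (N (d + 2)) := by
      have := subsingleton_ker_of_projective (liftedCover_surjective hA (hp (d + 1)))
        (ker_liftedCover_le (hk (d + 1)))
      exact (kerReduce_surjective hA (p (d + 1)) (e (d + 1))).subsingleton
    have hnext : ∀ n, Subsingleton (N n) → Subsingleton (N (n + 1)) := fun n h => by
      have := subsingleton_of_minimal_cover (hk n)
      exact (e n).symm.injective.subsingleton
    have h4 := hnext _ (hnext _ h2)
    exact ⟨d + 2, ⟨{ (0 : N (d + 2) →ₗ[A] N (d + 2 + 2)) with
      invFun := 0
      left_inv := fun _ => Subsingleton.elim _ _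
      right_inv := fun _ => Subsingleton.elim _ _ }⟩⟩
  · have key := fun n => le_and_nonempty_equiv_of_projective hA hker hf (hp (d + n)) (e (d + n))
      (hp (d + n + 1)) (hk (d + n + 1)) (hproj n)
    obtain ⟨n, hn⟩ : ∃ n, b (d + n + 1) = b (d + n) := by
      by_contra! hcon
      have hlt : ∀ n, b (d + n) + n ≤ b d := by
        intro n
        induction n with
        | zero => simp
        | succ n ih =>
          have := lt_of_le_of_ne (key n).1 (hcon n)
          rw [← add_assoc d n 1]
          lia
      have := hlt (b d + 1)
      lia
    obtain ⟨ε⟩ := (key n).2 hn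
    exact ⟨d + n, ⟨ε ≪≫ₗ e (d + n + 1)⟩⟩

end HypersurfaceSyzygies

section FlatDescent

open scoped TensorProduct

variable {R A : Type} [CommRing R] [IsNoetherianRing R] [CommRing A]
  [IsLocalRing A] [Algebra R A] [Module.Flat R A] {M N : Type} [AddCommGroup M] [Module R M]
  [AddCommGroup N] [Module R N]

theorem exists_sub_baseChange_mem [Module.Finite R M]
    (hres : ∀ a : A, ∃ r : R, a - algebraMap R A r ∈ maximalIdeal A)
    (g : A ⊗[R] M →ₗ[A] A ⊗[R] N) :
    ∃ ψ : M →ₗ[R] N, ∀ x, g x - ψ.baseChange A x ∈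
      maximalIdeal A • (⊤ : Submodule A (A ⊗[R] N)) := by
  have : Module.FinitePresentation R M := Module.finitePresentation_of_finite R M
  obtain ⟨t, rfl⟩ := (Module.FinitePresentation.isBaseChange_map R M N A).equiv.surjective g
  induction t using TensorProduct.induction_on with
  | zero => exact ⟨0, fun x => by simp⟩
  | tmul a ψ =>
    obtain ⟨r, hr⟩ := hres a
    refine ⟨r • ψ, fun x => ?_⟩
    rw [IsBaseChange.equiv_tmul, LinearMap.baseChange_smul, LinearMap.smul_apply,
      LinearMap.smul_apply, ← algebraMap_smul A r, LinearMap.baseChangeHom_apply, ← sub_smul]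
    exact Submodule.smul_mem_smul hr trivial
  | add s t hs ht =>
    obtain ⟨ψ, hψ⟩ := hs
    obtain ⟨χ, hχ⟩ := ht
    refine ⟨ψ + χ, fun x => ?_⟩
    rw [map_add, LinearMap.add_apply, LinearMap.baseChange_add, LinearMap.add_apply,
      add_sub_add_comm]
    exact add_mem (hψ x) (hχ x)

theorem exists_surjective_of_baseChange [IsLocalRing R] [IsLocalHom (algebraMap R A)]
    [Module.Finite R M] [Module.Finite R N] (hres : ∀ a : A, ∃ r : R, a - algebraMap R A r ∈ maximalIdeal A)
    {g : A ⊗[R] M →ₗ[A] A ⊗[R] N} (hg : Function.Surjective g) :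
    ∃ ψ : M →ₗ[R] N, Function.Surjective ψ := by
  obtain ⟨ψ, hψ⟩ := exists_sub_baseChange_mem hres g
  refine ⟨ψ, ?_⟩
  have : Module.FaithfullyFlat R A := Module.FaithfullyFlat.of_flat_of_isLocalHom
  rw [← Module.FaithfullyFlat.lTensor_surjective_iff_surjective R A]
  change Function.Surjective (ψ.baseChange A)
  rw [← LinearMap.range_eq_top]
  refine top_le_iff.mp (Submodule.le_of_le_smul_of_le_jacobson_bot Module.Finite.fg_top
    (IsLocalRing.maximalIdeal_le_jacobson ⊥) fun y _ => ?_)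
  obtain ⟨x, rfl⟩ := hg y
  rw [← add_sub_cancel (ψ.baseChange A x) (g x)]
  exact Submodule.add_mem_sup ⟨x, rfl⟩ (hψ x)

theorem nonempty_linearEquiv_of_baseChange [IsLocalRing R] [IsLocalHom (algebraMap R A)]
    [Module.Finite R M] [Module.Finite R N] (hres : ∀ a : A, ∃ r : R, a - algebraMap R A r ∈ maximalIdeal A)
    (e : A ⊗[R] M ≃ₗ[A] A ⊗[R] N) : Nonempty (M ≃ₗ[R] N) := by
  obtain ⟨ψ, hψ⟩ := exists_surjective_of_baseChange hres (g := e.toLinearMap) e.surjective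
  obtain ⟨χ, hχ⟩ := exists_surjective_of_baseChange hres (g := e.symm.toLinearMap) e.symm.surjective
  have hinj : Function.Injective (χ ∘ₗ ψ) :=
    OrzechProperty.injective_of_surjective_endomorphism _ (hχ.comp hψ)
  exact ⟨LinearEquiv.ofBijective ψ ⟨.of_comp hinj, hψ⟩⟩

end FlatDescent

section BaseChangeCover

open scoped TensorProduct

theorem exists_baseChange_minimal_cover {R : Type} (A : Type) {F M K : Type} [CommRing R]
    [IsLocalRing R] [CommRing A] [IsLocalRing A] [Algebra R A] [Module.Flat R A]
    [IsLocalHom (algebraMap R A)] [AddCommGroup F] [Module R F] [Module.Free R F]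
    [Module.Finite R F] [AddCommGroup M] [Module R M] [AddCommGroup K] [Module R K]
    {q : F →ₗ[R] M} (hq : Function.Surjective q)
    (hk : LinearMap.ker q ≤ maximalIdeal R • (⊤ : Submodule R F)) (e : K ≃ₗ[R] LinearMap.ker q) :
    ∃ p : (Fin (Module.finrank R F) → A) →ₗ[A] A ⊗[R] M, Function.Surjective p ∧
      LinearMap.ker p ≤
        maximalIdeal A • (⊤ : Submodule A (Fin (Module.finrank R F) → A)) ∧
      Nonempty (LinearMap.ker p ≃ₗ[A] A ⊗[R] K) := by
  let ε : (Fin (Module.finrank R F) → A) ≃ₗ[A] A ⊗[R] F :=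
    ((Module.finBasis R F).baseChange A).equivFun.symm
  let i : K →ₗ[R] F := (LinearMap.ker q).subtype ∘ₗ e.toLinearMap
  have hi : Function.Injective i := (LinearMap.ker q).injective_subtype.comp e.injective
  have hiq : Function.Exact i q := fun x =>
    ⟨fun hx => ⟨e.symm ⟨x, hx⟩, by simp [i]⟩, by rintro ⟨y, rfl⟩; exact (e y).2⟩
  let j : A ⊗[R] K →ₗ[A] (Fin (Module.finrank R F) → A) :=
    ε.symm.toLinearMap ∘ₗ i.baseChange A
  let p : (Fin (Module.finrank R F) → A) →ₗ[A] A ⊗[R] M := q.baseChange A ∘ₗ ε.toLinearMap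
  have hj : Function.Injective j :=
    ε.symm.injective.comp (Module.Flat.lTensor_preserves_injective_linearMap i hi)
  have hrange : LinearMap.range j = LinearMap.ker p := by
    have hex : Function.Exact (i.baseChange A) (q.baseChange A) := lTensor_exact A hiq hq
    ext x
    rw [LinearMap.mem_ker, LinearMap.mem_range]
    refine (exists_congr fun y => ?_).trans (hex (ε x)).symm
    exact ε.symm_apply_eq
  have hmem : ∀ x ∈ maximalIdeal R • (⊤ : Submodule R F),
      (1 : A) ⊗ₜ[R] x ∈ maximalIdeal A • (⊤ : Submodule A (A ⊗[R] F)) := by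
    intro x hx
    refine Submodule.smul_induction_on hx (fun r hr x _ => ?_) fun x y hx hy => ?_
    · rw [TensorProduct.tmul_smul, ← algebraMap_smul A r]
      exact Submodule.smul_mem_smul (map_nonunit (algebraMap R A) r hr) trivial
    · rw [TensorProduct.tmul_add]
      exact add_mem hx hy
  refine ⟨p, (LinearMap.lTensor_surjective A hq).comp ε.surjective, ?_,
    ⟨(LinearEquiv.ofEq _ _ hrange.symm).trans (LinearEquiv.ofInjective j hj).symm⟩⟩
  rw [← hrange]
  rintro _ ⟨z, rfl⟩
  have : i.baseChange A z ∈ maximalIdeal A • (⊤ : Submodule A (A ⊗[R] F)) := by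
    induction z using TensorProduct.induction_on with
    | zero => simp
    | tmul a x =>
      rw [LinearMap.baseChange_tmul, ← mul_one a, ← smul_eq_mul, ← TensorProduct.smul_tmul']
      exact Submodule.smul_mem _ a (hmem _ (hk (e x).2))
    | add x y hx hy =>
      rw [map_add]
      exact add_mem hx hy
  exact Submodule.smul_top_le_comap_smul_top _ ε.symm.toLinearMap this

end BaseChangeCover

instance MinFreeRes.finite_syz {R M : Type} [CommRing R] [IsLocalRing R] [AddCommGroup M]
    [Module R M] (C : MinFreeRes R M) (n : ℕ) : Module.Finite R (C.Syz n) :=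
  Module.Finite.of_surjective (C.cover n) (C.cover_surjective n)

theorem exists_periodic_of_isHypersurface {R : Type} [CommRing R] [IsLocalRing R]
    [IsNoetherianRing R] (h : IsHypersurface R) (C : MinFreeRes R (ResidueField R)) :
    ∃ n, Nonempty (C.Syz n ≃ₗ[R] C.Syz (n + 2)) := by
  obtain ⟨S, _, _, _, hS, f, ⟨φ⟩⟩ := h
  have := isRegularLocalRing_of_isRegularLocal hS
  let A := AdicCompletion (maximalIdeal R) R
  let : Algebra S A := (φ.symm.toRingHom.comp (Ideal.Quotient.mk _)).toAlgebra
  have hA : Function.Surjective (algebraMap S A) :=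
    φ.symm.surjective.comp Ideal.Quotient.mk_surjective
  have hker : RingHom.ker (algebraMap S A) = Ideal.span {f} := by
    ext x
    rw [RingHom.mem_ker, ← Ideal.Quotient.eq_zero_iff_mem]
    exact φ.symm.map_eq_zero_iff
  choose p hp hk e using fun n => exists_baseChange_minimal_cover A (C.cover_surjective n)
    (C.ker_cover_le n) (C.syzSuccEquiv n)
  let e₀ : TensorProduct R A (C.Syz 0) ≃ₗ[A] A ⧸ maximalIdeal A :=
    (Algebra.TensorProduct.quotIdealMapEquivTensorQuot A (maximalIdeal R)).symm.toLinearEquiv.trans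
      (Submodule.quotEquivOfEq _ _ AdicCompletion.maximalIdeal_eq_map.symm)
  obtain ⟨n, ⟨g⟩⟩ := exists_nonempty_equiv_add_two hA hker
    (fun n => TensorProduct R A (C.Syz n)) _ p hp hk (fun n => (e n).some) e₀
  exact ⟨n, nonempty_linearEquiv_of_baseChange (exists_sub_algebraMap_mem R) g⟩

/-- The minimal free resolution of the residue field `k` is eventually periodic iff
`R` is a hypersurface. -/
theorem stmt_19 (R : Type) [CommRing R] [IsLocalRing R] [IsNoetherianRing R] :
    (∃ (C : MinFreeRes R (ResidueField R)) (n a : ℕ), 0 < a ∧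
        Nonempty (C.Syz n ≃ₗ[R] C.Syz (n + a))) ↔ IsHypersurface R := by
  constructor
  · rintro ⟨C, n, a, ha, h⟩
    obtain ⟨B, hB⟩ := C.exists_finrank_le_of_periodic ha h
    exact isHypersurface_of_bounded C hB
  · intro h
    obtain ⟨C⟩ := nonempty_minFreeRes (R := R) (ResidueField R)
    obtain ⟨n, hn⟩ := exists_periodic_of_isHypersurface h C
    exact ⟨C, n, 2, two_pos, hn⟩
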